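/- arXiv:2603.11301 — 2 statements merged into one kernel-verified Lean document; each statement's English description precedes it below -/
import Mathlib

section
/- For every α ∈ (0,1/2) and every f ∈ 𝒲₁, the function ℜ_α(f) is non-increasing on [0,∞) and the function x ↦ ℜ_α(f)(√x) is convex on [0,∞). -/
open Real MeasureTheory Set Filter BoundedContinuousFunction

noncomputable section

namespace GSQGhalfplane

/-- The constant `c_{0,α} = 2^{2α-1} Γ(1+α) / (π Γ(1-α))`. -/
def C0 (α : ℝ) : ℝ := (2:ℝ) ^ (2*α - 1) * Real.Gamma (1 + α) / (π * Real.Gamma (1 - α))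

/-- The constant `c'''_{0,α}`. -/
def C3 (α : ℝ) : ℝ :=
  ((4:ℝ) ^ (1 + α) - 4 + α - 4*α^3) * Real.Gamma α /
    (2*π*α*(5 - 2*α)*(3 - 2*α)*(1 - 2*α)*Real.Gamma (2 - α))

/-- The exponent `δ_u = c'''_{0,α} t₀^{1/2-α} / (1 + c'''_{0,α} t₀^{1/2-α})`. -/
def deltaU (α t0 : ℝ) : ℝ :=
  C3 α * t0 ^ (1/2 - α) / (1 + C3 α * t0 ^ (1/2 - α))

/-- The lower barrier `f_l(x) = (1 + t₀^{-2} x²)^{-δ_l}`. -/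
def fl (t0 δl x : ℝ) : ℝ := (1 + x^2 / t0^2) ^ (-δl)

/-- The upper barrier `f_u(x) = min(1, t₀^{δ_u} |x|^{-δ_u})` (with value `1` at `x = 0`). -/
def fu (α t0 x : ℝ) : ℝ :=
  if x = 0 then 1 else min 1 (t0 ^ deltaU α t0 * |x| ^ (-(deltaU α t0)))

/-- The invariant set `𝒲₁`: even continuous bounded functions with `f(0)=1`,
nonnegative and non-increasing on `[0,∞)`, `x ↦ f(√x)` convex,
`f_l ≤ f ≤ f_u`, and left derivative at `t₀` at most `-t₀^{α-3/2}`. -/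
def W1 (α t0 δl : ℝ) (f : ℝ → ℝ) : Prop :=
  Continuous f ∧ (∃ M : ℝ, ∀ x : ℝ, |f x| ≤ M) ∧ (∀ x : ℝ, f (-x) = f x) ∧
  f 0 = 1 ∧ (∀ x ∈ Ici (0:ℝ), 0 ≤ f x) ∧ AntitoneOn f (Ici (0:ℝ)) ∧
  ConvexOn ℝ (Ici (0:ℝ)) (fun x => f (Real.sqrt x)) ∧
  (∀ x : ℝ, fl t0 δl x ≤ f x) ∧ (∀ x : ℝ, f x ≤ fu α t0 x) ∧
  (∃ d : ℝ, HasDerivWithinAt f d (Iio t0) t0 ∧ d ≤ -(t0 ^ (α - 3/2)))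

/-- The linear operator `𝔗_α(f)`, defined for `x > 0`, set to `0` at `x = 0`,
and extended evenly to `ℝ` (via `|x|`). -/
def Tfr (α : ℝ) (f : ℝ → ℝ) (x : ℝ) : ℝ :=
  if x = 0 then 0
  else (C0 α / α) * ∫ ξ in Ioi (0:ℝ),
    f ξ * (4*α * ξ ^ (-(2*α)) - (ξ / |x|) * (|(|x| - ξ)| ^ (-(2*α)) - (|x| + ξ) ^ (-(2*α))))

/-- The nonlinear map `ℜ_α(f)(x) = exp(-∫₀^{|x|} 𝔗_α(f)(y)/(y(1+𝔗_α(f)(y))) dy)`. -/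
def Rfr (α : ℝ) (f : ℝ → ℝ) (x : ℝ) : ℝ :=
  Real.exp (-(∫ y in (0:ℝ)..|x|, Tfr α f y / (y * (1 + Tfr α f y))))

/-- The functional `𝔟(f) = 4 c_{0,α} ∫₀^∞ f(ξ) ξ^{-2α} dξ`. -/
def bfr (α : ℝ) (f : ℝ → ℝ) : ℝ := 4 * C0 α * ∫ ξ in Ioi (0:ℝ), f ξ * ξ ^ (-(2*α))

/-- The functional `𝔠(f) = (8(1+2α)(1+α)/3) c_{0,α} ∫₀^∞ (1-f(ξ)) ξ^{-2-2α} dξ`. -/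
def cfr (α : ℝ) (f : ℝ → ℝ) : ℝ :=
  (8*(1+2*α)*(1+α)/3) * C0 α * ∫ ξ in Ioi (0:ℝ), (1 - f ξ) * ξ ^ (-2 - 2*α)

/-- The lower bound `b'_α`. -/
def bLow (α t0 δl : ℝ) : ℝ :=
  2 * C0 α * t0 ^ (1 - 2*α) * Real.Gamma (1/2 - α) * Real.Gamma (α + δl - 1/2) /
    Real.Gamma δl

/-- The upper bound `b''_α`. -/
def bHigh (α t0 : ℝ) : ℝ :=
  4 * C0 α * t0 ^ (1 - 2*α) * (1/(1 - 2*α) + 1/(deltaU α t0 + 2*α - 1))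

/-- The upper bound `c''_{0,α}`. -/
def cHigh (α t0 δl : ℝ) : ℝ :=
  C0 α * t0 ^ (-1 - 2*α) * 8 * (1 + α) * Real.Gamma (1/2 - α) *
    Real.Gamma (δl + α + 1/2) / (3 * Real.Gamma δl)

theorem continuous_mul_abs_rpow {r : ℝ} (hr : -1 < r) : Continuous fun t : ℝ => t * |t| ^ r := by
  rw [continuous_iff_continuousAt]
  intro t
  by_cases ht : t = 0
  · subst ht
    have h1 : Tendsto (fun t : ℝ => |t| ^ (1 + r)) (nhds 0) (nhds 0) := by
      have : Continuous fun t : ℝ => |t| ^ (1 + r) :=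
        continuous_abs.rpow_const fun _ => Or.inr (by linarith)
      have h := this.tendsto 0
      rwa [abs_zero, Real.zero_rpow (by linarith)] at h
    have h2 : Tendsto (fun t : ℝ => t * |t| ^ r) (nhds 0) (nhds 0) := by
      refine squeeze_zero_norm (fun t => le_of_eq ?_) h1
      rw [norm_mul, Real.norm_eq_abs, Real.norm_eq_abs, abs_of_nonneg (by positivity : 0 ≤ |t| ^ r),
        Real.rpow_one_add' (abs_nonneg t) (by linarith)]
    simpa [ContinuousAt] using h2
  · exact continuousAt_id.mul
      (continuous_abs.continuousAt.rpow_const (Or.inl (abs_ne_zero.mpr ht)))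

theorem hasDerivAt_abs_rpow {r t : ℝ} (ht : t ≠ 0) :
    HasDerivAt (fun t : ℝ => |t| ^ r) (r * |t| ^ r / t) t := by
  have h := (hasDerivAt_abs ht).rpow_const (p := r) (Or.inl (abs_ne_zero.mpr ht))
  convert h using 1
  rw [Real.rpow_sub_one (abs_ne_zero.mpr ht)]
  rcases lt_or_gt_of_ne ht with h | h
  · rw [abs_of_neg h, sign_neg h]
    simp only [SignType.coe_neg_one]
    field_simp
  · rw [abs_of_pos h, sign_pos h]
    simp only [SignType.coe_one]
    field_simp

theorem intervalIntegrable_abs_rpow {r : ℝ} (hr : -1 < r) (a b : ℝ) :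
    IntervalIntegrable (fun t : ℝ => |t| ^ r) volume a b := by
  have pos : ∀ c : ℝ, 0 ≤ c → IntervalIntegrable (fun t : ℝ => |t| ^ r) volume 0 c := by
    intro c hc
    refine (intervalIntegral.intervalIntegrable_rpow' hr (a := 0) (b := c)).congr ?_
    intro t ht
    rw [uIoc_of_le hc] at ht
    simp only [abs_of_pos ht.1]
  have all : ∀ c : ℝ, IntervalIntegrable (fun t : ℝ => |t| ^ r) volume 0 c := by
    intro c
    rcases le_total 0 c with hc | hc
    · exact pos c hc
    · have h := (pos (-c) (by linarith)).comp_sub_left 0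
      simpa using h
  exact (all a).symm.trans (all b)

theorem intervalIntegrable_abs_sub_rpow {r : ℝ} (hr : -1 < r) (x a b : ℝ) :
    IntervalIntegrable (fun t : ℝ => |t - x| ^ r) volume a b := by
  simpa using (intervalIntegrable_abs_rpow hr (a - x) (b - x)).comp_sub_right x

/-- The polynomial factor of the primitive of `(ξ - ξ³) |ξ - x| ^ r`, where `t = ξ - x`. -/
def cubicPrimitive (r ξ t : ℝ) : ℝ :=
  (ξ - ξ ^ 3) * t / (r + 1) - (1 - 3 * ξ ^ 2) * t ^ 2 / ((r + 1) * (r + 2))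
    + (-6 * ξ) * t ^ 3 / ((r + 1) * (r + 2) * (r + 3))
    + 6 * t ^ 4 / ((r + 1) * (r + 2) * (r + 3) * (r + 4))

theorem integral_cubic_mul_abs_rpow {r : ℝ} (hr : -1 < r) (x : ℝ) :
    ∫ ξ in (0:ℝ)..1, (ξ - ξ ^ 3) * |ξ - x| ^ r =
      |1 - x| ^ r * cubicPrimitive r 1 (1 - x) - |x| ^ r * cubicPrimitive r 0 (-x) := by
  have h1 : r + 1 ≠ 0 := by linarith
  have h2 : r + 2 ≠ 0 := by linarith
  have h3 : r + 3 ≠ 0 := by linarith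
  have h4 : r + 4 ≠ 0 := by linarith
  have key := MeasureTheory.integral_eq_of_hasDerivAt_off_countable
    (fun ξ : ℝ => |ξ - x| ^ r * cubicPrimitive r ξ (ξ - x))
    (fun ξ : ℝ => (ξ - ξ ^ 3) * |ξ - x| ^ r) (a := 0) (b := 1) (countable_singleton x) ?_ ?_ ?_
  · rw [key]; simp
  · apply Continuous.continuousOn
    have hc : Continuous fun ξ : ℝ => (ξ - x) * |ξ - x| ^ r :=
      (continuous_mul_abs_rpow hr).comp (continuous_id.sub continuous_const)
    have : (fun ξ : ℝ => |ξ - x| ^ r * cubicPrimitive r ξ (ξ - x)) = fun ξ =>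
        ((ξ - x) * |ξ - x| ^ r) * ((ξ - ξ ^ 3) / (r + 1)
        - (1 - 3 * ξ ^ 2) * (ξ - x) / ((r + 1) * (r + 2))
        + (-6 * ξ) * (ξ - x) ^ 2 / ((r + 1) * (r + 2) * (r + 3))
        + 6 * (ξ - x) ^ 3 / ((r + 1) * (r + 2) * (r + 3) * (r + 4))) := by
      funext ξ; unfold cubicPrimitive; ring
    rw [this]
    exact hc.mul (by fun_prop)
  · rintro ξ ⟨-, hξ⟩
    have ht : ξ - x ≠ 0 := sub_ne_zero.mpr hξ
    have hs : HasDerivAt (fun ξ : ℝ => ξ - x) 1 ξ := (hasDerivAt_id ξ).sub_const x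
    have hd1 : HasDerivAt (fun ξ : ℝ => |ξ - x| ^ r) (r * |ξ - x| ^ r / (ξ - x)) ξ := by
      exact ((hasDerivAt_abs_rpow (r := r) ht).comp ξ hs).congr_deriv (mul_one _)
    have hq : HasDerivAt (fun ξ : ℝ => ξ - ξ ^ 3) (1 - 3 * ξ ^ 2) ξ := by
      exact ((hasDerivAt_id ξ).sub (hasDerivAt_pow 3 ξ)).congr_deriv (by norm_num)
    have hq' : HasDerivAt (fun ξ : ℝ => 1 - 3 * ξ ^ 2) (-6 * ξ) ξ := by
      refine (((hasDerivAt_pow 2 ξ).const_mul 3).const_sub 1).congr_deriv ?_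
      norm_num
      ring
    have hq'' : HasDerivAt (fun ξ : ℝ => -6 * ξ) (-6) ξ := by
      simpa using (hasDerivAt_id ξ).const_mul (-6 : ℝ)
    have hd2 := (((((hq.mul hs).div_const (r + 1)).sub
      ((hq'.mul (hs.pow 2)).div_const ((r + 1) * (r + 2)))).add
      ((hq''.mul (hs.pow 3)).div_const ((r + 1) * (r + 2) * (r + 3)))).add
      (((hs.pow 4).const_mul 6).div_const ((r + 1) * (r + 2) * (r + 3) * (r + 4))))
    have hd := hd1.mul hd2
    refine HasDerivAt.congr_deriv (f' := _) hd ?_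
    simp only [Pi.mul_apply, Pi.pow_apply, Pi.add_apply, Pi.sub_apply]
    push_cast
    field_simp
    ring
  · exact ((intervalIntegrable_abs_sub_rpow hr x 0 1).continuousOn_mul (by fun_prop))

/-- `∫ ξ in 0..1, (ξ - ξ³) (|ξ - x| ^ r - |ξ + x| ^ r)` equals
`edge r (1 - x) - edge r (1 + x)`. -/
def edge (r t : ℝ) : ℝ :=
  |t| ^ r * (2 / ((r + 1) * (r + 2)) * t ^ 2 - 6 / ((r + 1) * (r + 2) * (r + 3)) * t ^ 3
    + 6 / ((r + 1) * (r + 2) * (r + 3) * (r + 4)) * t ^ 4)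

/-- The derivative of `edge`. -/
def edgeDeriv (r t : ℝ) : ℝ :=
  t * |t| ^ r * (2 / (r + 1) - 6 / ((r + 1) * (r + 2)) * t
    + 6 / ((r + 1) * (r + 2) * (r + 3)) * t ^ 2)

theorem continuous_edgeDeriv {r : ℝ} (hr : -1 < r) : Continuous (edgeDeriv r) :=
  (continuous_mul_abs_rpow hr).mul (by fun_prop)

theorem continuous_edge {r : ℝ} (hr : -1 < r) : Continuous (edge r) := by
  have : edge r = fun t => t * |t| ^ r * (2 / ((r + 1) * (r + 2)) * t
      - 6 / ((r + 1) * (r + 2) * (r + 3)) * t ^ 2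
      + 6 / ((r + 1) * (r + 2) * (r + 3) * (r + 4)) * t ^ 3) := by
    funext t; unfold edge; ring
  rw [this]
  exact (continuous_mul_abs_rpow hr).mul (by fun_prop)

theorem hasDerivAt_edge {r : ℝ} (hr : -1 < r) (t : ℝ) :
    HasDerivAt (edge r) (edgeDeriv r t) t := by
  have h1 : r + 1 ≠ 0 := by linarith
  have h2 : r + 2 ≠ 0 := by linarith
  have h3 : r + 3 ≠ 0 := by linarith
  have h4 : r + 4 ≠ 0 := by linarith
  have hne : ∀ t : ℝ, t ≠ 0 → HasDerivAt (edge r) (edgeDeriv r t) t := by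
    intro t ht
    have hd := (hasDerivAt_abs_rpow (r := r) ht).mul
      ((((hasDerivAt_pow 2 t).const_mul (2 / ((r + 1) * (r + 2)))).sub
      ((hasDerivAt_pow 3 t).const_mul (6 / ((r + 1) * (r + 2) * (r + 3))))).add
      ((hasDerivAt_pow 4 t).const_mul (6 / ((r + 1) * (r + 2) * (r + 3) * (r + 4)))))
    refine HasDerivAt.congr_deriv (f' := _) hd ?_
    simp only [Pi.add_apply, Pi.sub_apply]
    unfold edgeDeriv
    push_cast
    field_simp
    ring
  by_cases ht : t = 0
  · subst ht
    exact hasDerivAt_of_hasDerivAt_of_ne (fun y hy => hne y hy)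
      (continuous_edge hr).continuousAt (continuous_edgeDeriv hr).continuousAt
  · exact hne t ht

/-- The odd potential of `ξ ↦ ξ (1 - ξ²)₊`. -/
def bumpPotential (r x : ℝ) : ℝ := edge r (1 - x) - edge r (1 + x)

def bumpPotentialDeriv (r x : ℝ) : ℝ := -edgeDeriv r (1 - x) - edgeDeriv r (1 + x)

theorem hasDerivAt_bumpPotential {r : ℝ} (hr : -1 < r) (x : ℝ) :
    HasDerivAt (bumpPotential r) (bumpPotentialDeriv r x) x := by
  have h1 := (hasDerivAt_edge hr (1 - x)).comp x ((hasDerivAt_id x).const_sub 1)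
  have h2 := (hasDerivAt_edge hr (1 + x)).comp x ((hasDerivAt_id x).const_add 1)
  refine HasDerivAt.congr_deriv (h1.sub h2) ?_
  unfold bumpPotentialDeriv; ring

theorem bumpPotential_eq_integral {r : ℝ} (hr : -1 < r) (x : ℝ) :
    bumpPotential r x =
      ∫ ξ in (0:ℝ)..1, (ξ - ξ ^ 3) * (|x - ξ| ^ r - |x + ξ| ^ r) := by
  have e : ∀ ξ : ℝ, (ξ - ξ ^ 3) * (|x - ξ| ^ r - |x + ξ| ^ r) =
      (ξ - ξ ^ 3) * |ξ - x| ^ r - (ξ - ξ ^ 3) * |ξ - -x| ^ r := by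
    intro ξ; rw [abs_sub_comm x ξ, sub_neg_eq_add, add_comm x ξ]; ring
  simp_rw [e]
  rw [intervalIntegral.integral_sub
    ((intervalIntegrable_abs_sub_rpow hr x 0 1).continuousOn_mul (by fun_prop))
    ((intervalIntegrable_abs_sub_rpow hr (-x) 0 1).continuousOn_mul (by fun_prop)),
    integral_cubic_mul_abs_rpow hr, integral_cubic_mul_abs_rpow hr]
  unfold bumpPotential edge cubicPrimitive
  rw [abs_neg, sub_neg_eq_add, neg_neg]
  ring

theorem nonneg_of_hasDerivAt_nonneg {u u' : ℝ → ℝ} (h0 : u 0 = 0)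
    (hd : ∀ x ∈ Ico (0:ℝ) 1, HasDerivAt u (u' x) x) (hu : ∀ x ∈ Ico (0:ℝ) 1, 0 ≤ u' x) :
    ∀ x ∈ Ico (0:ℝ) 1, 0 ≤ u x := by
  have hm : MonotoneOn u (Ico (0:ℝ) 1) := by
    refine monotoneOn_of_deriv_nonneg (convex_Ico 0 1)
      (fun x hx => (hd x hx).continuousAt.continuousWithinAt) ?_ ?_
    · intro x hx
      exact (hd x (interior_subset hx)).differentiableAt.differentiableWithinAt
    · intro x hx
      rw [(hd x (interior_subset hx)).deriv]
      exact hu x (interior_subset hx)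
  intro x hx
  rw [← h0]
  exact hm ⟨le_rfl, one_pos⟩ hx hx.1

theorem odd_rpow_numerator_nonneg {κ β : ℝ} (hβ : β ≤ 4)
    (h : 0 ≤ κ * (β * (β - 1) * (β - 2) * (β - 3))) :
    ∀ x ∈ Ico (0:ℝ) 1, 0 ≤ κ * (-x * β * ((1 - x) ^ (β - 1) + (1 + x) ^ (β - 1))
      - 3 * ((1 - x) ^ β - (1 + x) ^ β) - 4 * β * x) := by
  have dm : ∀ γ : ℝ, ∀ x ∈ Ico (0:ℝ) 1,
      HasDerivAt (fun x : ℝ => (1 - x) ^ γ) (-γ * (1 - x) ^ (γ - 1)) x := by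
    intro γ x hx
    have := ((hasDerivAt_id x).const_sub 1).rpow_const (p := γ)
      (Or.inl (by simpa using (sub_pos.mpr hx.2).ne'))
    exact this.congr_deriv (by simp)
  have dp : ∀ γ : ℝ, ∀ x ∈ Ico (0:ℝ) 1,
      HasDerivAt (fun x : ℝ => (1 + x) ^ γ) (γ * (1 + x) ^ (γ - 1)) x := by
    intro γ x hx
    have := ((hasDerivAt_id x).const_add 1).rpow_const (p := γ)
      (Or.inl (by have := hx.1; simp only [id]; linarith))
    exact this.congr_deriv (by simp)
  have n3 : ∀ x ∈ Ico (0:ℝ) 1, 0 ≤ κ * (x * (β * (β - 1) * (β - 2) * (β - 3)) *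
      ((1 - x) ^ (β - 1 - 1 - 1 - 1) - (1 + x) ^ (β - 1 - 1 - 1 - 1))) := by
    intro x hx
    have hA : (1 + x) ^ (β - 1 - 1 - 1 - 1) ≤ (1 - x) ^ (β - 1 - 1 - 1 - 1) :=
      Real.rpow_le_rpow_of_nonpos (sub_pos.mpr hx.2) (by linarith [hx.1]) (by linarith)
    have := mul_nonneg (mul_nonneg h hx.1) (sub_nonneg.mpr hA)
    linarith
  have n2 : ∀ x ∈ Ico (0:ℝ) 1, 0 ≤ κ * (-x * (β * (β - 1) * (β - 2)) *
      ((1 - x) ^ (β - 1 - 1 - 1) + (1 + x) ^ (β - 1 - 1 - 1)) -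
      β * (β - 1) * ((1 - x) ^ (β - 1 - 1) - (1 + x) ^ (β - 1 - 1))) := by
    refine nonneg_of_hasDerivAt_nonneg (by simp) (fun x hx => ?_) n3
    have := ((((hasDerivAt_id x).neg.mul_const (β * (β - 1) * (β - 2))).mul
      ((dm (β - 1 - 1 - 1) x hx).add (dp (β - 1 - 1 - 1) x hx))).sub
      (((dm (β - 1 - 1) x hx).sub (dp (β - 1 - 1) x hx)).const_mul (β * (β - 1)))).const_mul κ
    refine this.congr_deriv ?_
    simp only [Pi.add_apply, Pi.neg_apply, id]
    ring
  have n1 : ∀ x ∈ Ico (0:ℝ) 1, 0 ≤ κ * (x * (β * (β - 1)) *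
      ((1 - x) ^ (β - 1 - 1) - (1 + x) ^ (β - 1 - 1)) +
      2 * β * ((1 - x) ^ (β - 1) + (1 + x) ^ (β - 1)) - 4 * β) := by
    refine nonneg_of_hasDerivAt_nonneg (by simp; right; ring) (fun x hx => ?_) n2
    have := (((((hasDerivAt_id x).mul_const (β * (β - 1))).mul
      ((dm (β - 1 - 1) x hx).sub (dp (β - 1 - 1) x hx))).add
      (((dm (β - 1) x hx).add (dp (β - 1) x hx)).const_mul (2 * β))).sub_const (4 * β)).const_mul κ
    refine this.congr_deriv ?_
    simp only [Pi.sub_apply, id]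
    ring
  refine nonneg_of_hasDerivAt_nonneg (by simp) (fun x hx => ?_) n1
  have := (((((hasDerivAt_id x).neg.mul_const β).mul
    ((dm (β - 1) x hx).add (dp (β - 1) x hx))).sub
    (((dm β x hx).sub (dp β x hx)).const_mul 3)).sub
    ((hasDerivAt_id x).const_mul (4 * β))).const_mul κ
  refine this.congr_deriv ?_
  simp only [Pi.add_apply, Pi.neg_apply, id]
  ring

/-- `∫ ξ in 0..1, -2 r (1 - ξ²) ξ ^ r`. -/
def bumpConst (r : ℝ) : ℝ := -4 * r / ((r + 1) * (r + 3))

theorem bumpConst_pos {r : ℝ} (hr : -1 < r) (hr0 : r < 0) : 0 < bumpConst r :=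
  div_pos (by linarith) (mul_pos (by linarith) (by linarith))

def bumpNumerator (r x : ℝ) : ℝ :=
  -2 * bumpConst r * x + 3 * bumpPotential r x - x * bumpPotentialDeriv r x

theorem continuous_bumpNumerator {r : ℝ} (hr : -1 < r) : Continuous (bumpNumerator r) := by
  have h1 : Continuous (bumpPotential r) :=
    continuous_iff_continuousAt.mpr fun x => (hasDerivAt_bumpPotential hr x).continuousAt
  have h2 : Continuous (bumpPotentialDeriv r) :=
    ((continuous_edgeDeriv hr).comp (by fun_prop : Continuous fun x : ℝ => 1 - x)).neg.sub
      ((continuous_edgeDeriv hr).comp (by fun_prop : Continuous fun x : ℝ => 1 + x))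
  unfold bumpNumerator
  fun_prop

theorem bumpNumerator_nonpos_of_lt_one {r : ℝ} (hr : -1 < r) (hr0 : r < 0) {x : ℝ}
    (hx : x ∈ Ico (0:ℝ) 1) : bumpNumerator r x ≤ 0 := by
  have h1 : 0 < r + 1 := by linarith
  have h2 : 0 < r + 2 := by linarith
  have h3 : 0 < r + 3 := by linarith
  have h4 : 0 < r + 4 := by linarith
  have m0 : 0 < -r := by linarith
  have m1 : 0 < 1 - r := by linarith
  have k2 := odd_rpow_numerator_nonneg (κ := 2 / ((r + 1) * (r + 2))) (β := r + 2)
    (by linarith) (by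
      have : 0 ≤ 2 / ((r + 1) * (r + 2)) * ((r + 2) * (r + 1) * (-r) * (1 - r)) := by positivity
      linarith) x hx
  have k3 := odd_rpow_numerator_nonneg (κ := -(6 / ((r + 1) * (r + 2) * (r + 3)))) (β := r + 3)
    (by linarith) (by
      have : 0 ≤ 6 / ((r + 1) * (r + 2) * (r + 3)) * ((r + 3) * (r + 2) * (r + 1) * (-r)) := by
        positivity
      linarith) x hx
  have k4 := odd_rpow_numerator_nonneg (κ := 6 / ((r + 1) * (r + 2) * (r + 3) * (r + 4)))
    (β := r + 4) (by linarith) (by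
      have : 0 ≤ 6 / ((r + 1) * (r + 2) * (r + 3) * (r + 4)) *
        ((r + 4) * (r + 3) * (r + 2) * (r + 1)) := by positivity
      linarith) x hx
  have pw : ∀ A : ℝ, 0 < A → A ^ (r + 2 - 1) = A ^ r * A ∧ A ^ (r + 2) = A ^ r * A ^ 2 ∧
      A ^ (r + 3 - 1) = A ^ r * A ^ 2 ∧ A ^ (r + 3) = A ^ r * A ^ 3 ∧
      A ^ (r + 4 - 1) = A ^ r * A ^ 3 ∧ A ^ (r + 4) = A ^ r * A ^ 4 := by
    intro A hA
    have e : ∀ n : ℕ, A ^ (r + n) = A ^ r * A ^ n := fun n => Real.rpow_add_natCast hA.ne' r n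
    refine ⟨?_, ?_, ?_, ?_, ?_, ?_⟩
    · rw [show r + 2 - 1 = r + (1 : ℕ) by push_cast; ring, e, pow_one]
    · exact_mod_cast e 2
    · rw [show r + 3 - 1 = r + (2 : ℕ) by push_cast; ring, e]
    · exact_mod_cast e 3
    · rw [show r + 4 - 1 = r + (3 : ℕ) by push_cast; ring, e]
    · exact_mod_cast e 4
  have hA : 0 < 1 - x := sub_pos.mpr hx.2
  have hB : 0 < 1 + x := by linarith [hx.1]
  obtain ⟨a1, a2, a3, a4, a5, a6⟩ := pw _ hA
  obtain ⟨b1, b2, b3, b4, b5, b6⟩ := pw _ hB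
  rw [a1, a2, b1, b2] at k2
  rw [a3, a4, b3, b4] at k3
  rw [a5, a6, b5, b6] at k4
  have key := add_nonneg (add_nonneg k2 k3) k4
  unfold bumpNumerator bumpPotential bumpPotentialDeriv edge edgeDeriv bumpConst
  rw [abs_of_pos hA, abs_of_pos hB, ← neg_nonneg]
  refine key.trans_eq ?_
  generalize (1 - x) ^ r = u
  generalize (1 + x) ^ r = v
  field_simp
  ring

theorem antitoneOn_rpow_sub_rpow {s ξ : ℝ} (hs : s ≤ 0) (h0 : 0 ≤ ξ) (h1 : ξ < 1) :
    AntitoneOn (fun x : ℝ => (x - ξ) ^ s - (x + ξ) ^ s) (Ici 1) := by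
  have hd : ∀ x ∈ Ici (1:ℝ), HasDerivAt (fun x : ℝ => (x - ξ) ^ s - (x + ξ) ^ s)
      (s * (x - ξ) ^ (s - 1) - s * (x + ξ) ^ (s - 1)) x := by
    intro x hx
    have hx : 1 ≤ x := hx
    refine ((((hasDerivAt_id x).sub_const ξ).rpow_const (p := s) (Or.inl ?_)).sub
      (((hasDerivAt_id x).add_const ξ).rpow_const (p := s) (Or.inl ?_))).congr_deriv ?_
    · simp only [id]; linarith
    · simp only [id]; linarith
    · simp
  refine antitoneOn_of_deriv_nonpos (convex_Ici 1)
    (fun x hx => (hd x hx).continuousAt.continuousWithinAt)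
    (fun x hx => (hd x (interior_subset hx)).differentiableAt.differentiableWithinAt) ?_
  intro x hx
  rw [(hd x (interior_subset hx)).deriv]
  have hx : 1 ≤ x := interior_subset hx
  have : (x + ξ) ^ (s - 1) ≤ (x - ξ) ^ (s - 1) :=
    Real.rpow_le_rpow_of_nonpos (by linarith) (by linarith) (by linarith)
  nlinarith

theorem convexOn_rpow_sub_rpow {r ξ : ℝ} (hr : r ≤ 0) (h0 : 0 ≤ ξ) (h1 : ξ < 1) :
    ConvexOn ℝ (Ici 1) (fun x : ℝ => (x - ξ) ^ r - (x + ξ) ^ r) := by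
  have hd : ∀ x ∈ Ici (1:ℝ), HasDerivAt (fun x : ℝ => (x - ξ) ^ r - (x + ξ) ^ r)
      (r * (x - ξ) ^ (r - 1) - r * (x + ξ) ^ (r - 1)) x := by
    intro x hx
    have hx : 1 ≤ x := hx
    refine ((((hasDerivAt_id x).sub_const ξ).rpow_const (p := r) (Or.inl ?_)).sub
      (((hasDerivAt_id x).add_const ξ).rpow_const (p := r) (Or.inl ?_))).congr_deriv ?_
    · simp only [id]; linarith
    · simp only [id]; linarith
    · simp
  refine MonotoneOn.convexOn_of_deriv (convex_Ici 1)
    (fun x hx => (hd x hx).continuousAt.continuousWithinAt)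
    (fun x hx => (hd x (interior_subset hx)).differentiableAt.differentiableWithinAt) ?_
  intro x hx y hy hxy
  rw [(hd x (interior_subset hx)).deriv, (hd y (interior_subset hy)).deriv]
  have := antitoneOn_rpow_sub_rpow (s := r - 1) (by linarith) h0 h1 (interior_subset hx)
    (interior_subset hy) hxy
  simp only at this
  nlinarith

theorem intervalIntegrable_bumpPotential {r : ℝ} (hr : -1 < r) (x : ℝ) :
    IntervalIntegrable (fun ξ : ℝ => (ξ - ξ ^ 3) * (|x - ξ| ^ r - |x + ξ| ^ r)) volume 0 1 := by
  have e : (fun ξ : ℝ => (ξ - ξ ^ 3) * (|x - ξ| ^ r - |x + ξ| ^ r)) = fun ξ : ℝ =>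
      (ξ - ξ ^ 3) * |ξ - x| ^ r - (ξ - ξ ^ 3) * |ξ - -x| ^ r := by
    funext ξ; rw [abs_sub_comm x ξ, sub_neg_eq_add, add_comm x ξ]; ring
  rw [e]
  exact ((intervalIntegrable_abs_sub_rpow hr x 0 1).continuousOn_mul (by fun_prop)).sub
    ((intervalIntegrable_abs_sub_rpow hr (-x) 0 1).continuousOn_mul (by fun_prop))

theorem cubic_nonneg {ξ : ℝ} (hξ : ξ ∈ Icc (0:ℝ) 1) : 0 ≤ ξ - ξ ^ 3 := by
  have : ξ - ξ ^ 3 = ξ * ((1 - ξ) * (1 + ξ)) := by ring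
  rw [this]
  exact mul_nonneg hξ.1 (mul_nonneg (by linarith [hξ.2]) (by linarith [hξ.1]))

theorem convexOn_bumpPotential {r : ℝ} (hr : -1 < r) (hr0 : r < 0) :
    ConvexOn ℝ (Ici 1) (bumpPotential r) := by
  refine ⟨convex_Ici 1, fun x hx y hy a b ha hb hab => ?_⟩
  have hz : a • x + b • y ∈ Ici (1:ℝ) := convex_Ici 1 hx hy ha hb hab
  simp only [bumpPotential_eq_integral hr]
  rw [smul_eq_mul a (∫ _ in _.._, _), smul_eq_mul b (∫ _ in _.._, _),
    ← intervalIntegral.integral_const_mul,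
    ← intervalIntegral.integral_const_mul, ← intervalIntegral.integral_add
      ((intervalIntegrable_bumpPotential hr x).const_mul a)
      ((intervalIntegrable_bumpPotential hr y).const_mul b)]
  refine intervalIntegral.integral_mono_on zero_le_one (intervalIntegrable_bumpPotential hr _)
    (((intervalIntegrable_bumpPotential hr x).const_mul a).add
      ((intervalIntegrable_bumpPotential hr y).const_mul b)) fun ξ hξ => ?_
  rcases eq_or_lt_of_le hξ.2 with h1 | h1
  · simp [h1]
  · have hc := (convexOn_rpow_sub_rpow hr0.le hξ.1 h1).2 hx hy ha hb hab
    have e : ∀ z ∈ Ici (1:ℝ), |z - ξ| ^ r - |z + ξ| ^ r = (z - ξ) ^ r - (z + ξ) ^ r := by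
      intro z hz
      have hz : 1 ≤ z := hz
      rw [abs_of_pos (by linarith), abs_of_pos (by linarith [hξ.1])]
    rw [e _ hx, e _ hy]
    rw [e _ hz]
    have := mul_le_mul_of_nonneg_left hc (cubic_nonneg hξ)
    simp only [smul_eq_mul] at this ⊢
    linarith

theorem bumpPotential_le_one {r : ℝ} (hr : -1 < r) (hr0 : r < 0) {x : ℝ} (hx : 1 ≤ x) :
    bumpPotential r x ≤ bumpPotential r 1 := by
  simp only [bumpPotential_eq_integral hr]
  refine intervalIntegral.integral_mono_on zero_le_one (intervalIntegrable_bumpPotential hr _)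
    (intervalIntegrable_bumpPotential hr _) fun ξ hξ => ?_
  rcases eq_or_lt_of_le hξ.2 with h1 | h1
  · simp [h1]
  · have := antitoneOn_rpow_sub_rpow hr0.le hξ.1 h1 (mem_Ici.mpr le_rfl) hx hx
    simp only at this
    have h0 := hξ.1
    rw [abs_of_pos (by linarith), abs_of_pos (by linarith), abs_of_pos (by linarith),
      abs_of_pos (by linarith)]
    exact mul_le_mul_of_nonneg_left this (cubic_nonneg hξ)

theorem bumpPotential_one_nonneg {r : ℝ} (hr : -1 < r) (hr0 : r < 0) :
    0 ≤ bumpPotential r 1 := by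
  rw [bumpPotential_eq_integral hr]
  refine intervalIntegral.integral_nonneg zero_le_one fun ξ hξ => ?_
  rcases eq_or_lt_of_le hξ.2 with h1 | h1
  · simp [h1]
  · have h0 := hξ.1
    rw [abs_of_pos (by linarith), abs_of_pos (by linarith)]
    exact mul_nonneg (cubic_nonneg hξ) (sub_nonneg.mpr
      (Real.rpow_le_rpow_of_nonpos (by linarith) (by linarith) hr0.le))

theorem bumpNumerator_nonpos {r : ℝ} (hr : -1 < r) (hr0 : r < 0) {x : ℝ} (hx : 0 ≤ x) :
    bumpNumerator r x ≤ 0 := by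
  rcases lt_or_ge x 1 with h1 | h1
  · exact bumpNumerator_nonpos_of_lt_one hr hr0 ⟨hx, h1⟩
  have one : bumpNumerator r 1 ≤ 0 := by
    have hcl : (1:ℝ) ∈ closure (Ico (0:ℝ) 1) := by
      rw [closure_Ico zero_ne_one]; exact ⟨zero_le_one, le_rfl⟩
    exact closure_minimal (fun x hx => bumpNumerator_nonpos_of_lt_one hr hr0 hx)
      (isClosed_le (continuous_bumpNumerator hr) continuous_const) hcl
  rcases eq_or_lt_of_le h1 with h | h
  · rwa [← h]
  have c := convexOn_bumpPotential hr hr0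
  have d1 := c.le_slope_of_hasDerivAt (mem_Ici.mpr le_rfl) (mem_Ici.mpr h1) h
    (hasDerivAt_bumpPotential hr 1)
  have d2 := c.slope_le_of_hasDerivAt (mem_Ici.mpr le_rfl) (mem_Ici.mpr h1) h
    (hasDerivAt_bumpPotential hr x)
  have d := d1.trans d2
  have p := bumpPotential_le_one hr hr0 h1
  have p1 := bumpPotential_one_nonneg hr hr0
  unfold bumpNumerator at one ⊢
  nlinarith [mul_le_mul_of_nonneg_left d hx, mul_le_mul_of_nonneg_right h1 p1,
    mul_le_mul_of_nonneg_left one hx]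

/-- `x⁻²` times the transform of `ξ ↦ (1 - ξ²)₊`. -/
def bumpQuotient (r x : ℝ) : ℝ := (bumpConst r - bumpPotential r x / x) / x ^ 2

theorem antitoneOn_bumpQuotient {r : ℝ} (hr : -1 < r) (hr0 : r < 0) :
    AntitoneOn (bumpQuotient r) (Ioi 0) := by
  have hd : ∀ x ∈ Ioi (0:ℝ), HasDerivAt (bumpQuotient r) (bumpNumerator r x / x ^ 4) x := by
    intro x hx
    have hx0 : x ≠ 0 := ne_of_gt hx
    refine ((((hasDerivAt_bumpPotential hr x).div (hasDerivAt_id x) hx0).const_sub _).div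
      (hasDerivAt_pow 2 x) (pow_ne_zero 2 hx0)).congr_deriv ?_
    simp only [Pi.div_apply, id, bumpNumerator]
    push_cast
    field_simp
    ring
  refine antitoneOn_of_deriv_nonpos (convex_Ioi 0)
    (fun x hx => (hd x hx).continuousAt.continuousWithinAt)
    (fun x hx => (hd x (interior_subset hx)).differentiableAt.differentiableWithinAt) ?_
  intro x hx
  have hx : 0 < x := interior_subset hx
  rw [(hd x hx).deriv]
  exact div_nonpos_of_nonpos_of_nonneg (bumpNumerator_nonpos hr hr0 hx.le) (by positivity)

theorem bumpQuotient_nonneg {r : ℝ} (hr : -1 < r) (hr0 : r < 0) {x : ℝ} (hx : 0 < x) :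
    0 ≤ bumpQuotient r x := by
  have hc := bumpConst_pos hr hr0
  set y := max x (max 1 (bumpPotential r 1 / bumpConst r)) with hy
  have hxy : x ≤ y := le_max_left _ _
  have h1y : 1 ≤ y := (le_max_left _ _).trans (le_max_right _ _)
  have hpy : bumpPotential r 1 / bumpConst r ≤ y := (le_max_right _ _).trans (le_max_right _ _)
  have hy0 : 0 < y := by linarith
  refine le_trans ?_ (antitoneOn_bumpQuotient hr hr0 hx (mem_Ioi.mpr hy0) hxy)
  refine div_nonneg (sub_nonneg.mpr ?_) (by positivity)
  rw [div_le_iff₀ hy0]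
  rw [div_le_iff₀ hc] at hpy
  linarith [bumpPotential_le_one hr hr0 h1y]

/-- The kernel of the linear operator, with `r = -2α`. -/
def kern (r x ξ : ℝ) : ℝ := -2 * r * ξ ^ r - (ξ / x) * (|x - ξ| ^ r - (x + ξ) ^ r)

theorem integral_bump_mul_kern {r : ℝ} (hr : -1 < r) {x : ℝ} (hx : 0 < x) :
    ∫ ξ in Ioi (0:ℝ), max (1 - ξ ^ 2) 0 * kern r x ξ = x ^ 2 * bumpQuotient r x := by
  have hsub : ∫ ξ in Ioi (0:ℝ), max (1 - ξ ^ 2) 0 * kern r x ξ =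
      ∫ ξ in Ioc (0:ℝ) 1, max (1 - ξ ^ 2) 0 * kern r x ξ := by
    refine setIntegral_eq_of_subset_of_forall_sdiff_eq_zero measurableSet_Ioi
      Ioc_subset_Ioi_self ?_
    rintro ξ ⟨h0, h1⟩
    have h1 : 1 < ξ := by
      by_contra hcon
      exact h1 ⟨h0, not_lt.mp hcon⟩
    rw [max_eq_right (by nlinarith), zero_mul]
  have hcong : ∫ ξ in Ioc (0:ℝ) 1, max (1 - ξ ^ 2) 0 * kern r x ξ =
      ∫ ξ in Ioc (0:ℝ) 1, ((-2 * r * (ξ ^ r - ξ ^ (r + 2))) -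
        x⁻¹ * ((ξ - ξ ^ 3) * (|x - ξ| ^ r - |x + ξ| ^ r))) := by
    refine setIntegral_congr_fun measurableSet_Ioc fun ξ hξ => ?_
    have h0 := hξ.1
    have h2 : ξ ^ (r + 2) = ξ ^ r * ξ ^ 2 := by exact_mod_cast Real.rpow_add_natCast h0.ne' r 2
    rw [max_eq_left (by nlinarith [hξ.2]), abs_of_pos (by linarith : 0 < x + ξ), h2, kern]
    field_simp
  have i1 := intervalIntegral.intervalIntegrable_rpow' hr (a := 0) (b := 1)
  have i2 := intervalIntegral.intervalIntegrable_rpow' (r := r + 2) (by linarith) (a := 0) (b := 1)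
  rw [hsub, hcong, ← intervalIntegral.integral_of_le zero_le_one,
    intervalIntegral.integral_sub ((i1.sub i2).const_mul _)
      ((intervalIntegrable_bumpPotential hr x).const_mul _),
    intervalIntegral.integral_const_mul, intervalIntegral.integral_const_mul,
    intervalIntegral.integral_sub i1 i2, ← bumpPotential_eq_integral hr,
    integral_rpow (Or.inl hr), integral_rpow (Or.inl (by linarith)), bumpQuotient, bumpConst,
    Real.one_rpow, Real.one_rpow, Real.zero_rpow (by linarith), Real.zero_rpow (by linarith)]
  have h1 : r + 1 ≠ 0 := by linarith
  have h3 : r + 3 ≠ 0 := by linarith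
  have h3' : r + 2 + 1 ≠ 0 := by linarith
  field_simp
  ring

theorem kern_mul_left {r a x ξ : ℝ} (ha : 0 < a) (hx : 0 < x) (hξ : 0 < ξ) :
    kern r x (a * ξ) = a ^ r * kern r (x / a) ξ := by
  have e1 : x - a * ξ = a * (x / a - ξ) := by field_simp
  have e2 : x + a * ξ = a * (x / a + ξ) := by field_simp
  have : 0 < x / a := div_pos hx ha
  unfold kern
  rw [e1, e2, abs_mul, abs_of_pos ha, Real.mul_rpow ha.le (abs_nonneg _),
    Real.mul_rpow ha.le (by linarith : 0 ≤ x / a + ξ), Real.mul_rpow ha.le hξ.le]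
  field_simp

theorem setIntegral_mul_kern_scale {r a x : ℝ} (ha : 0 < a) (hx : 0 < x) (g : ℝ → ℝ) :
    ∫ ξ in Ioi (0:ℝ), g ξ * kern r x ξ =
      a * a ^ r * ∫ ξ in Ioi (0:ℝ), g (a * ξ) * kern r (x / a) ξ := by
  have h := integral_comp_mul_left_Ioi (fun ξ : ℝ => g ξ * kern r x ξ) 0 ha
  rw [mul_zero, smul_eq_mul, eq_inv_mul_iff_mul_eq₀ ha.ne'] at h
  rw [← h, mul_assoc, ← integral_const_mul (a ^ r)]
  congr 1
  refine setIntegral_congr_fun measurableSet_Ioi fun ξ hξ => ?_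
  simp only [kern_mul_left ha hx hξ]
  ring

theorem measurable_kern (r x : ℝ) : Measurable (kern r x) := by
  unfold kern
  fun_prop

theorem abs_kern_one_le {r s : ℝ} (hr : -1 < r) (hr0 : r < 0) (hs : 2 < s) :
    |kern r 1 s| ≤ 2 * s ^ (r - 1) := by
  have hs0 : 0 < s := by linarith
  obtain ⟨ρ, hρ⟩ : ∃ ρ, ρ = s⁻¹ := ⟨_, rfl⟩
  have hρ0 : 0 < ρ := by rw [hρ]; positivity
  have hsρ : s * ρ = 1 := by rw [hρ]; field_simp
  have hρ1 : ρ < 1 / 2 := by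
    rw [hρ, inv_eq_one_div]; exact one_div_lt_one_div_of_lt (by norm_num) hs
  have hm : 0 < 1 - ρ := by linarith
  have hp : 0 < 1 + ρ := by linarith
  have m_inv : (1 - ρ) ^ r = ((1 - ρ)⁻¹) ^ (-r) := by
    rw [Real.inv_rpow hm.le, Real.rpow_neg hm.le, inv_inv]
  have p_inv : (1 + ρ) ^ r = ((1 + ρ)⁻¹) ^ (-r) := by
    rw [Real.inv_rpow hp.le, Real.rpow_neg hp.le, inv_inv]
  have bern : ∀ t : ℝ, 0 ≤ t → t ^ (-r) ≤ 1 + -r * (t - 1) := by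
    intro t ht
    have := rpow_one_add_le_one_add_mul_self (s := t - 1) (by linarith)
      (p := -r) (by linarith) (by linarith)
    rwa [add_sub_cancel] at this
  have up1 : (1 - ρ) ^ r ≤ 1 + -r * (ρ * (1 + 2 * ρ)) := by
    rw [m_inv]
    refine (bern _ (by positivity)).trans ?_
    have : (1 - ρ)⁻¹ - 1 ≤ ρ * (1 + 2 * ρ) := by
      rw [sub_le_iff_le_add, inv_le_iff_one_le_mul₀ hm]
      nlinarith [mul_pos hρ0 hρ0]
    nlinarith
  have up2 : (1 + ρ) ^ r ≤ 1 + -r * (-ρ + ρ ^ 2) := by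
    rw [p_inv]
    refine (bern _ (by positivity)).trans ?_
    have : (1 + ρ)⁻¹ - 1 ≤ -ρ + ρ ^ 2 := by
      rw [sub_le_iff_le_add, inv_le_iff_one_le_mul₀ hp]
      nlinarith [pow_pos hρ0 3]
    nlinarith
  have lo1 : 1 - r * ρ ≤ (1 - ρ) ^ r := by
    have h := bern _ hm.le
    have hpos : 0 < (1 - ρ) ^ (-r) := Real.rpow_pos_of_pos hm _
    have e : (1 - ρ) ^ r = ((1 - ρ) ^ (-r))⁻¹ := by rw [Real.rpow_neg hm.le, inv_inv]
    rw [e, le_inv_comm₀ (by nlinarith) hpos]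
    refine h.trans ?_
    rw [le_inv_comm₀ (by nlinarith) (by nlinarith), ← one_div, le_div_iff₀ (by nlinarith)]
    nlinarith [mul_pos hρ0 hρ0, sq_nonneg (r * ρ)]
  have lo2 : 1 + r * ρ ≤ (1 + ρ) ^ r := by
    have h := bern _ hp.le
    have hpos : 0 < (1 + ρ) ^ (-r) := Real.rpow_pos_of_pos hp _
    have e : (1 + ρ) ^ r = ((1 + ρ) ^ (-r))⁻¹ := by rw [Real.rpow_neg hp.le, inv_inv]
    rw [e, le_inv_comm₀ (by nlinarith) hpos]
    refine h.trans ?_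
    rw [le_inv_comm₀ (by nlinarith) (by nlinarith), ← one_div, le_div_iff₀ (by nlinarith)]
    nlinarith [sq_nonneg (r * ρ)]
  have e1 : |1 - s| ^ r = s ^ r * (1 - ρ) ^ r := by
    rw [← Real.mul_rpow hs0.le hm.le, abs_of_neg (by linarith)]
    congr 1; linarith
  have e2 : (1 + s) ^ r = s ^ r * (1 + ρ) ^ r := by
    rw [← Real.mul_rpow hs0.le hp.le]
    congr 1; linarith
  have e3 : kern r 1 s = s ^ r * (-2 * r - s * ((1 - ρ) ^ r - (1 + ρ) ^ r)) := by
    unfold kern; rw [e1, e2]; ring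
  rw [e3, abs_mul, abs_of_pos (Real.rpow_pos_of_pos hs0 r), Real.rpow_sub_one hs0.ne',
    div_eq_mul_inv, ← hρ, mul_left_comm]
  refine mul_le_mul_of_nonneg_left ?_ (Real.rpow_pos_of_pos hs0 r).le
  have u : s * ((1 - ρ) ^ r - (1 + ρ) ^ r) ≤ s * (-2 * r * ρ + -2 * r * ρ ^ 2) :=
    mul_le_mul_of_nonneg_left (by nlinarith) hs0.le
  have l : s * (-2 * r * ρ + r * ρ ^ 2) ≤ s * ((1 - ρ) ^ r - (1 + ρ) ^ r) :=
    mul_le_mul_of_nonneg_left (by nlinarith) hs0.le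
  have eu : s * (-2 * r * ρ + -2 * r * ρ ^ 2) = -2 * r + -2 * r * ρ := by
    linear_combination (-2 * r + -2 * r * ρ) * hsρ
  have el : s * (-2 * r * ρ + r * ρ ^ 2) = -2 * r + r * ρ := by
    linear_combination (-2 * r + r * ρ) * hsρ
  rw [abs_le]
  constructor <;> nlinarith

theorem integrableOn_kern_one {r : ℝ} (hr : -1 < r) (hr0 : r < 0) :
    IntegrableOn (kern r 1) (Ioi 0) := by
  rw [← Ioc_union_Ioi_eq_Ioi (zero_le_two : (0:ℝ) ≤ 2)]
  refine IntegrableOn.union ?_ ?_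
  · have h1 := (intervalIntegral.intervalIntegrable_rpow' hr (a := 0) (b := 2)).const_mul (-2 * r)
    have h2 := (intervalIntegrable_abs_sub_rpow hr 1 0 2).continuousOn_mul
      (g := fun ξ => ξ) (by fun_prop)
    have h3 := (intervalIntegrable_abs_sub_rpow hr (-1) 0 2).continuousOn_mul
      (g := fun ξ => ξ) (by fun_prop)
    have h := (h1.sub (h2.sub h3))
    rw [intervalIntegrable_iff_integrableOn_Ioc_of_le zero_le_two] at h
    refine h.congr_fun (fun ξ hξ => ?_) measurableSet_Ioc
    have h0 := hξ.1
    simp only [kern]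
    rw [abs_sub_comm 1 ξ, sub_neg_eq_add, abs_of_pos (by linarith : 0 < ξ + 1), add_comm ξ 1]
    ring
  · have h := (integrableOn_Ioi_rpow_of_lt (a := r - 1) (by linarith) (c := 2) two_pos).const_mul 2
    refine Integrable.mono' h (measurable_kern r 1).aestronglyMeasurable ?_
    refine (ae_restrict_iff' measurableSet_Ioi).mpr (Eventually.of_forall fun s hs => ?_)
    exact abs_kern_one_le hr hr0 hs

theorem integrableOn_kern {r x : ℝ} (hr : -1 < r) (hr0 : r < 0) (hx : 0 < x) :
    IntegrableOn (kern r x) (Ioi 0) := by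
  have h := integrableOn_Ioi_comp_mul_left_iff (kern r x) 0 hx
  rw [mul_zero] at h
  rw [← h]
  refine IntegrableOn.congr_fun ((integrableOn_kern_one hr hr0).const_mul (x ^ r))
    (fun ξ hξ => ?_) measurableSet_Ioi
  simp only [kern_mul_left hx hx hξ, div_self (ne_of_gt hx)]

/-- The truncated affine function `u ↦ (a - u)₊`. -/
def tent (a u : ℝ) : ℝ := max (a - u) 0

theorem integral_tent_mul_kern {r a x : ℝ} (hr : -1 < r) (ha : 0 < a) (hx : 0 < x) :
    ∫ ξ in Ioi (0:ℝ), tent a (ξ ^ 2) * kern r x ξ =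
      x ^ 2 * (√a * √a ^ r * bumpQuotient r (x / √a)) := by
  have hb : 0 < √a := Real.sqrt_pos.mpr ha
  have hb2 : √a ^ 2 = a := Real.sq_sqrt ha.le
  rw [setIntegral_mul_kern_scale hb hx]
  have e : ∀ ξ : ℝ, tent a ((√a * ξ) ^ 2) * kern r (x / √a) ξ =
      √a ^ 2 * (max (1 - ξ ^ 2) 0 * kern r (x / √a) ξ) := by
    intro ξ
    have : tent a ((√a * ξ) ^ 2) = √a ^ 2 * max (1 - ξ ^ 2) 0 := by
      rw [tent, mul_max_of_nonneg _ _ (sq_nonneg _), mul_pow, hb2]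
      congr 1 <;> ring
    rw [this, mul_assoc]
  simp_rw [e]
  rw [integral_const_mul, integral_bump_mul_kern hr (div_pos hx hb)]
  field_simp

section Cone

theorem continuous_tent (a : ℝ) : Continuous (tent a) := by unfold tent; fun_prop

theorem tent_nonneg (a u : ℝ) : 0 ≤ tent a u := le_max_right _ _

theorem tent_le {a u : ℝ} (ha : 0 ≤ a) (hu : 0 ≤ u) : tent a u ≤ a :=
  max_le (by linarith) ha

variable {W : ℝ → ℝ}

theorem integrableOn_bounded_mul (hW : IntegrableOn W (Ioi 0)) {φ : ℝ → ℝ} (hφ : Continuous φ)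
    {C : ℝ} (hC : ∀ u, 0 ≤ u → |φ u| ≤ C) :
    IntegrableOn (fun ξ => φ (ξ ^ 2) * W ξ) (Ioi 0) :=
  Integrable.bdd_mul hW (hφ.comp (continuous_pow 2)).aestronglyMeasurable
    (Eventually.of_forall fun ξ => hC _ (sq_nonneg ξ))

theorem integral_nonneg_of_tendsto (hW : IntegrableOn W (Ioi 0)) {φ : ℕ → ℝ → ℝ} {g : ℝ → ℝ}
    (hφ : ∀ n, Continuous (φ n)) {C : ℝ} (hC : ∀ n u, 0 ≤ u → |φ n u| ≤ C)
    (hlim : ∀ u, 0 ≤ u → Tendsto (fun n => φ n u) atTop (nhds (g u)))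
    (hpos : ∀ n, 0 ≤ ∫ ξ in Ioi (0:ℝ), φ n (ξ ^ 2) * W ξ) :
    0 ≤ ∫ ξ in Ioi (0:ℝ), g (ξ ^ 2) * W ξ := by
  have h : Tendsto (fun n => ∫ ξ in Ioi (0:ℝ), φ n (ξ ^ 2) * W ξ) atTop
      (nhds (∫ ξ in Ioi (0:ℝ), g (ξ ^ 2) * W ξ)) := by
    refine tendsto_integral_of_dominated_convergence (fun ξ => C * |W ξ|)
      (fun n => (integrableOn_bounded_mul hW (hφ n) (hC n)).aestronglyMeasurable)
      (hW.abs.const_mul C) (fun n => Eventually.of_forall fun ξ => ?_)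
      (Eventually.of_forall fun ξ => (hlim _ (sq_nonneg ξ)).mul_const _)
    rw [norm_mul, Real.norm_eq_abs, Real.norm_eq_abs]
    exact mul_le_mul_of_nonneg_right (hC n _ (sq_nonneg ξ)) (abs_nonneg _)
  exact ge_of_tendsto' h hpos

theorem integral_nonneg_of_tent (hW : IntegrableOn W (Ioi 0))
    (ht : ∀ a, 0 < a → 0 ≤ ∫ ξ in Ioi (0:ℝ), tent a (ξ ^ 2) * W ξ) :
    0 ≤ ∫ ξ in Ioi (0:ℝ), W ξ := by
  have h := integral_nonneg_of_tendsto hW (φ := fun n u => tent (n + 1) u * ((n:ℝ) + 1)⁻¹)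
    (g := fun _ => 1) (fun n => (continuous_tent _).mul_const _) (C := 1) ?_ ?_ ?_
  · simpa using h
  · intro n u hu
    have hn : (0:ℝ) < n + 1 := by positivity
    rw [abs_of_nonneg (mul_nonneg (tent_nonneg _ _) (by positivity)), ← div_eq_mul_inv,
      div_le_one hn]
    exact tent_le hn.le hu
  · intro u hu
    have h0 : Tendsto (fun n : ℕ => 1 - u * (1 / ((n:ℝ) + 1))) atTop (nhds 1) := by
      simpa using (tendsto_one_div_add_atTop_nhds_zero_nat (𝕜 := ℝ)).const_mul u |>.const_sub 1
    refine h0.congr' ?_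
    filter_upwards [eventually_ge_atTop ⌈u⌉₊] with n hn
    have hun : u ≤ n := Nat.ceil_le.mp hn
    have hn : (0:ℝ) < n + 1 := by positivity
    rw [tent, max_eq_left (by linarith)]
    field_simp
  · intro n
    simp_rw [mul_right_comm]
    rw [integral_mul_const]
    exact mul_nonneg (ht _ (by positivity)) (by positivity)

/-- The piecewise affine interpolation of `g` at the nodes `0, h, …, N h`. -/
def interp (g : ℝ → ℝ) (h : ℝ) (N : ℕ) (u : ℝ) : ℝ :=
  g (N * h) + ∑ k ∈ Finset.range N,
    (g (k * h) - g ((k + 1 : ℕ) * h)) / h * (tent ((k + 1 : ℕ) * h) u - tent (k * h) u)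

theorem interp_succ (g : ℝ → ℝ) (h : ℝ) (N : ℕ) (u : ℝ) :
    interp g h (N + 1) u = interp g h N u + (g (N * h) - g ((N + 1 : ℕ) * h)) / h *
      (tent ((N + 1 : ℕ) * h) u - tent (N * h) u) - (g (N * h) - g ((N + 1 : ℕ) * h)) := by
  unfold interp
  rw [Finset.sum_range_succ]
  ring

theorem interp_node (g : ℝ → ℝ) {h : ℝ} (hh : 0 < h) {j N : ℕ} (hj : j ≤ N) :
    interp g h N (j * h) = g (j * h) := by
  induction N, hj using Nat.le_induction with
  | base =>
    unfold interp
    rw [Finset.sum_eq_zero, add_zero]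
    intro k hk
    have hk : k + 1 ≤ j := Finset.mem_range.mp hk
    have h1 : ((k + 1 : ℕ):ℝ) * h ≤ j * h :=
      mul_le_mul_of_nonneg_right (by exact_mod_cast hk) hh.le
    have h2 : (k:ℝ) * h ≤ j * h :=
      mul_le_mul_of_nonneg_right (by exact_mod_cast (Nat.le_succ k).trans hk) hh.le
    rw [tent, tent, max_eq_right (by linarith), max_eq_right (by linarith), sub_zero, mul_zero]
  | succ N hN ih =>
    have h2 : (j:ℝ) * h ≤ N * h :=
      mul_le_mul_of_nonneg_right (by exact_mod_cast hN) hh.le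
    have h1 : ((N + 1 : ℕ):ℝ) * h = N * h + h := by push_cast; ring
    rw [interp_succ, ih, tent, tent, max_eq_left (by linarith), max_eq_left (by linarith), h1]
    field_simp
    ring

theorem continuous_interp (g : ℝ → ℝ) (h : ℝ) (N : ℕ) : Continuous (interp g h N) := by
  unfold interp tent
  fun_prop

variable {g : ℝ → ℝ}

theorem node_sub_nonneg (hg : AntitoneOn g (Ici 0)) {h : ℝ} (hh : 0 < h) (k : ℕ) :
    0 ≤ g (k * h) - g ((k + 1 : ℕ) * h) :=
  sub_nonneg.mpr (hg (mem_Ici.mpr (by positivity)) (mem_Ici.mpr (by positivity))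
    (mul_le_mul_of_nonneg_right (by exact_mod_cast Nat.le_succ k) hh.le))

theorem interp_antitone (hg : AntitoneOn g (Ici 0)) {h : ℝ} (hh : 0 < h) (N : ℕ) :
    Antitone (interp g h N) := by
  intro u v huv
  unfold interp
  refine add_le_add_right (Finset.sum_le_sum fun k _ => mul_le_mul_of_nonneg_left ?_
    (div_nonneg (node_sub_nonneg hg hh k) hh.le)) _
  have h1 : ((k + 1 : ℕ):ℝ) * h = k * h + h := by push_cast; ring
  rw [h1]
  generalize (k:ℝ) * h = a
  unfold tent
  rcases max_cases (a + h - v) 0 with ⟨e1, _⟩ | ⟨e1, _⟩ <;>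
  rcases max_cases (a - v) 0 with ⟨e2, _⟩ | ⟨e2, _⟩ <;>
  rcases max_cases (a + h - u) 0 with ⟨e3, _⟩ | ⟨e3, _⟩ <;>
  rcases max_cases (a - u) 0 with ⟨e4, _⟩ | ⟨e4, _⟩ <;>
  rw [e1, e2, e3, e4] <;> linarith

theorem abs_interp_le (hg : AntitoneOn g (Ici 0)) (hg0 : ∀ u, 0 ≤ u → 0 ≤ g u) {h : ℝ}
    (hh : 0 < h) (N : ℕ) {u : ℝ} (hu : 0 ≤ u) : |interp g h N u| ≤ g 0 := by
  rw [abs_of_nonneg]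
  · have := interp_node g hh (Nat.zero_le N)
    rw [Nat.cast_zero, zero_mul] at this
    rw [← this]
    exact interp_antitone hg hh N hu
  · refine add_nonneg (hg0 _ (by positivity)) (Finset.sum_nonneg fun k _ =>
      mul_nonneg (div_nonneg (node_sub_nonneg hg hh k) hh.le) (sub_nonneg.mpr ?_))
    refine max_le_max (sub_le_sub_right (mul_le_mul_of_nonneg_right ?_ hh.le) _) le_rfl
    exact_mod_cast Nat.le_succ k

theorem tendsto_interp (hgc : Continuous g) (hg : AntitoneOn g (Ici 0)) {u : ℝ} (hu : 0 ≤ u) :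
    Tendsto (fun n : ℕ => interp g ((n:ℝ) + 1)⁻¹ ((n + 1) * (n + 1)) u) atTop (nhds (g u)) := by
  have hfl : Tendsto (fun n : ℕ => (⌊u * ((n:ℝ) + 1)⌋₊ : ℝ) * ((n:ℝ) + 1)⁻¹) atTop (nhds u) := by
    have h := (tendsto_nat_floor_mul_div_atTop hu).comp
      (tendsto_atTop_add_const_right atTop (1:ℝ) tendsto_natCast_atTop_atTop)
    simpa [Function.comp_def, div_eq_mul_inv] using h
  have hfl' : Tendsto (fun n : ℕ => ((⌊u * ((n:ℝ) + 1)⌋₊ + 1 : ℕ) : ℝ) * ((n:ℝ) + 1)⁻¹) atTop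
      (nhds u) := by
    have h := hfl.add (tendsto_one_div_add_atTop_nhds_zero_nat (𝕜 := ℝ))
    rw [add_zero] at h
    refine h.congr fun n => ?_
    push_cast
    ring
  refine tendsto_of_tendsto_of_tendsto_of_le_of_le' ((hgc.tendsto u).comp hfl')
    ((hgc.tendsto u).comp hfl) ?_ ?_
  · filter_upwards [eventually_ge_atTop ⌈u⌉₊] with n hn
    have hun : u ≤ n := Nat.ceil_le.mp hn
    have hn : (0:ℝ) < n + 1 := by positivity
    have hle : ⌊u * ((n:ℝ) + 1)⌋₊ + 1 ≤ (n + 1) * (n + 1) := by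
      have h1 : ⌊u * ((n:ℝ) + 1)⌋₊ ≤ n * (n + 1) := by
        refine Nat.floor_le_of_le ?_
        push_cast
        exact mul_le_mul_of_nonneg_right hun hn.le
      nlinarith
    simp only [Function.comp_apply]
    rw [← interp_node g (inv_pos.mpr hn) hle]
    refine interp_antitone hg (inv_pos.mpr hn) _ ?_
    rw [← div_eq_mul_inv, le_div_iff₀ hn]
    push_cast
    exact (Nat.lt_floor_add_one _).le
  · filter_upwards [eventually_ge_atTop ⌈u⌉₊] with n hn
    have hun : u ≤ n := Nat.ceil_le.mp hn
    have hn : (0:ℝ) < n + 1 := by positivity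
    have hle : ⌊u * ((n:ℝ) + 1)⌋₊ ≤ (n + 1) * (n + 1) := by
      refine Nat.floor_le_of_le ?_
      push_cast
      exact mul_le_mul_of_nonneg_right (by linarith) hn.le
    simp only [Function.comp_apply]
    rw [← interp_node g (inv_pos.mpr hn) hle]
    refine interp_antitone hg (inv_pos.mpr hn) _ ?_
    rw [← div_eq_mul_inv, div_le_iff₀ hn]
    exact Nat.floor_le (by positivity)

theorem integral_interp_nonneg (hW : IntegrableOn W (Ioi 0))
    (ht : ∀ a, 0 < a → 0 ≤ ∫ ξ in Ioi (0:ℝ), tent a (ξ ^ 2) * W ξ)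
    (hgx : ConvexOn ℝ (Ici 0) g) (hg : AntitoneOn g (Ici 0)) (hg0 : ∀ u, 0 ≤ u → 0 ≤ g u)
    {h : ℝ} (hh : 0 < h) (N : ℕ) :
    0 ≤ ∫ ξ in Ioi (0:ℝ), interp g h N (ξ ^ 2) * W ξ := by
  have hi : ∀ k : ℕ, IntegrableOn (fun ξ => tent (k * h) (ξ ^ 2) * W ξ) (Ioi 0) := fun k =>
    integrableOn_bounded_mul hW (continuous_tent _) (C := k * h) fun u hu => by
      rw [abs_of_nonneg (tent_nonneg _ _)]; exact tent_le (by positivity) hu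
  set ℓ : ℕ → ℝ := fun k => ∫ ξ in Ioi (0:ℝ), tent (k * h) (ξ ^ 2) * W ξ with hℓ
  set d : ℕ → ℝ := fun k => (g (k * h) - g ((k + 1 : ℕ) * h)) / h with hd
  have hℓ0 : ∀ k, 0 ≤ ℓ k := by
    intro k
    rcases Nat.eq_zero_or_pos k with rfl | hk
    · have : ∀ ξ : ℝ, tent ((0:ℕ) * h) (ξ ^ 2) = 0 := fun ξ => by
        rw [Nat.cast_zero, zero_mul]; exact max_eq_right (by nlinarith [sq_nonneg ξ])
      simp only [hℓ, this, zero_mul, integral_zero, le_refl]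
    · exact ht _ (by positivity)
  have hℓz : ℓ 0 = 0 := by
    have : ∀ ξ : ℝ, tent ((0:ℕ) * h) (ξ ^ 2) = 0 := fun ξ => by
      rw [Nat.cast_zero, zero_mul]; exact max_eq_right (by nlinarith [sq_nonneg ξ])
    simp only [hℓ, this, zero_mul, integral_zero]
  have hdanti : ∀ k, d (k + 1) ≤ d k := by
    intro k
    have hk : ∀ j : ℕ, (j:ℝ) * h ∈ Ici (0:ℝ) := fun j => mem_Ici.mpr (by positivity)
    have hc := hgx.2 (hk k) (hk (k + 1 + 1)) (by norm_num : (0:ℝ) ≤ 1 / 2)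
      (by norm_num : (0:ℝ) ≤ 1 / 2) (by norm_num)
    have e : (1 / 2 : ℝ) • ((k:ℝ) * h) + (1 / 2 : ℝ) • (((k + 1 + 1 : ℕ):ℝ) * h) =
        ((k + 1 : ℕ):ℝ) * h := by
      simp only [smul_eq_mul]; push_cast; ring
    rw [e] at hc
    simp only [smul_eq_mul] at hc
    simp only [hd]
    exact div_le_div_of_nonneg_right (by linarith) hh.le
  have hsum : ∀ N : ℕ, d N * ℓ N ≤ ∑ k ∈ Finset.range N, d k * (ℓ (k + 1) - ℓ k) := by
    intro N
    induction N with
    | zero => simp [hℓz]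
    | succ N ih =>
      rw [Finset.sum_range_succ]
      nlinarith [mul_le_mul_of_nonneg_right (hdanti N) (hℓ0 (N + 1))]
  have hint : ∫ ξ in Ioi (0:ℝ), interp g h N (ξ ^ 2) * W ξ =
      g (N * h) * (∫ ξ in Ioi (0:ℝ), W ξ) + ∑ k ∈ Finset.range N, d k * (ℓ (k + 1) - ℓ k) := by
    have e : ∀ ξ : ℝ, interp g h N (ξ ^ 2) * W ξ = g (N * h) * W ξ + ∑ k ∈ Finset.range N,
        d k * (tent ((k + 1 : ℕ) * h) (ξ ^ 2) * W ξ - tent (k * h) (ξ ^ 2) * W ξ) := by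
      intro ξ
      simp only [interp, hd]
      rw [add_mul, Finset.sum_mul]
      congr 1
      exact Finset.sum_congr rfl fun k _ => by ring
    have hik : ∀ k ∈ Finset.range N, Integrable (fun ξ : ℝ => d k *
        (tent ((k + 1 : ℕ) * h) (ξ ^ 2) * W ξ - tent (k * h) (ξ ^ 2) * W ξ))
        (volume.restrict (Ioi 0)) := fun k _ => ((hi (k + 1)).sub (hi k)).const_mul _
    simp_rw [e]
    rw [integral_add (hW.const_mul _) (integrable_finsetSum _ hik), integral_const_mul,
      integral_finsetSum _ hik]
    congr 1
    refine Finset.sum_congr rfl fun k _ => ?_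
    rw [integral_const_mul, integral_sub (hi (k + 1)) (hi k)]
  rw [hint]
  exact add_nonneg (mul_nonneg (hg0 _ (by positivity)) (integral_nonneg_of_tent hW ht))
    ((mul_nonneg (div_nonneg (node_sub_nonneg hg hh N) hh.le) (hℓ0 N)).trans (hsum N))

theorem integral_nonneg_of_convexOn (hW : IntegrableOn W (Ioi 0))
    (ht : ∀ a, 0 < a → 0 ≤ ∫ ξ in Ioi (0:ℝ), tent a (ξ ^ 2) * W ξ) (hgc : Continuous g)
    (hgx : ConvexOn ℝ (Ici 0) g) (hg : AntitoneOn g (Ici 0)) (hg0 : ∀ u, 0 ≤ u → 0 ≤ g u) :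
    0 ≤ ∫ ξ in Ioi (0:ℝ), g (ξ ^ 2) * W ξ :=
  integral_nonneg_of_tendsto hW
    (fun n => continuous_interp g ((n:ℝ) + 1)⁻¹ ((n + 1) * (n + 1)))
    (fun n _ hu => abs_interp_le hg hg0 (by positivity) _ hu)
    (fun _ hu => tendsto_interp hgc hg hu)
    (fun _ => integral_interp_nonneg hW ht hgx hg hg0 (by positivity) _)

end Cone

section Exponential

variable {T : ℝ → ℝ} {C r : ℝ}

theorem antitoneOn_div_mul_one_add (hT : ∀ x, 0 < x → 0 ≤ T x)
    (hTa : AntitoneOn (fun x => T x / x ^ 2) (Ioi 0)) :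
    AntitoneOn (fun y => T y / (y * (1 + T y)) / y) (Ioi 0) := by
  intro x hx y hy hxy
  have hx : 0 < x := hx
  have hy : 0 < y := hy
  have h := hTa hx hy hxy
  have h1 := hT x hx
  have h2 := hT y hy
  simp only at h ⊢
  rw [div_le_div_iff₀ (by positivity) (by positivity)] at h
  rw [div_div, div_div, div_le_div_iff₀ (by positivity) (by positivity)]
  have h3 : T x * T y * x ^ 2 ≤ T x * T y * y ^ 2 :=
    mul_le_mul_of_nonneg_left (pow_le_pow_left₀ hx.le hxy 2) (mul_nonneg h1 h2)
  nlinarith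

theorem intervalIntegrable_div_mul_one_add (hr : -1 < r) (hT : ∀ x, 0 < x → 0 ≤ T x)
    (hTa : AntitoneOn (fun x => T x / x ^ 2) (Ioi 0))
    (hTC : ∀ x, 0 < x → T x ≤ C * x ^ (1 + r)) {a b : ℝ} (ha : 0 ≤ a) (hb : 0 ≤ b) :
    IntervalIntegrable (fun y => T y / (y * (1 + T y))) volume a b := by
  have main : ∀ b : ℝ, 0 ≤ b →
      IntervalIntegrable (fun y => T y / (y * (1 + T y))) volume 0 b := by
    intro b hb
    have hdom := (intervalIntegral.intervalIntegrable_rpow' hr (a := 0) (b := b)).const_mul C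
    rw [intervalIntegrable_iff_integrableOn_Ioc_of_le hb] at hdom ⊢
    refine Integrable.mono' hdom ?_ ?_
    · have hm : AEMeasurable (fun y => T y / (y * (1 + T y)) / y) (volume.restrict (Ioc 0 b)) :=
        aemeasurable_restrict_of_antitoneOn measurableSet_Ioc
          ((antitoneOn_div_mul_one_add hT hTa).mono Ioc_subset_Ioi_self)
      refine ((hm.mul aemeasurable_id).congr ?_).aestronglyMeasurable
      refine (ae_restrict_iff' measurableSet_Ioc).mpr (Eventually.of_forall fun y hy => ?_)
      simp only [Pi.mul_apply, id]
      exact div_mul_cancel₀ _ hy.1.ne'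
    · refine (ae_restrict_iff' measurableSet_Ioc).mpr (Eventually.of_forall fun y hy => ?_)
      have h0 : 0 < y := hy.1
      have h1 := hT y h0
      have h2 := hTC y h0
      rw [Real.norm_eq_abs, abs_of_nonneg (by positivity), div_le_iff₀ (by positivity)]
      rw [Real.rpow_add h0, Real.rpow_one] at h2
      nlinarith [mul_nonneg (h1.trans h2) h1]
  exact (main a ha).symm.trans (main b hb)

theorem concaveOn_integral_sqrt (hr : -1 < r) (hT : ∀ x, 0 < x → 0 ≤ T x)
    (hTa : AntitoneOn (fun x => T x / x ^ 2) (Ioi 0))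
    (hTC : ∀ x, 0 < x → T x ≤ C * x ^ (1 + r)) :
    ConcaveOn ℝ (Ici 0) (fun x => ∫ y in (0:ℝ)..√x, T y / (y * (1 + T y))) := by
  have hi : ∀ {a b : ℝ}, 0 ≤ a → 0 ≤ b →
      IntervalIntegrable (fun y => T y / (y * (1 + T y))) volume a b :=
    intervalIntegrable_div_mul_one_add hr hT hTa hTC
  have hanti := antitoneOn_div_mul_one_add hT hTa
  have hsub : ∀ x y : ℝ, (∫ s in (0:ℝ)..√y, T s / (s * (1 + T s))) -
      (∫ s in (0:ℝ)..√x, T s / (s * (1 + T s))) = ∫ s in √x..√y, T s / (s * (1 + T s)) :=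
    fun x y => intervalIntegral.integral_interval_sub_left (hi le_rfl (Real.sqrt_nonneg _))
      (hi le_rfl (Real.sqrt_nonneg _))
  refine concaveOn_of_slope_anti_adjacent (convex_Ici 0) fun {x y z} hx hz hxy hyz => ?_
  have hx : 0 ≤ x := hx
  have hz : 0 ≤ z := hz
  have hy : 0 < y := by linarith
  have hsy : 0 < √y := Real.sqrt_pos.mpr hy
  have hsxy : √x ≤ √y := Real.sqrt_le_sqrt hxy.le
  have hsyz : √y ≤ √z := Real.sqrt_le_sqrt hyz.le
  simp only [hsub]
  set κ := T √y / (√y * (1 + T √y)) / √y with hκ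
  have lin : ∀ a b : ℝ, 0 ≤ a → 0 ≤ b → ∫ s in √a..√b, κ * s = κ / 2 * (b - a) := by
    intro a b ha hb
    rw [intervalIntegral.integral_const_mul, integral_id, Real.sq_sqrt ha, Real.sq_sqrt hb]
    ring
  have ilin : ∀ a b : ℝ, IntervalIntegrable (fun s => κ * s) volume a b :=
    fun a b => (continuous_const.mul continuous_id).intervalIntegrable a b
  have upper : ∫ s in √y..√z, T s / (s * (1 + T s)) ≤ κ / 2 * (z - y) := by
    rw [← lin y z hy.le hz]
    refine intervalIntegral.integral_mono_on hsyz (hi hsy.le (Real.sqrt_nonneg _)) (ilin _ _)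
      fun s hs => ?_
    have hs0 : 0 < s := hsy.trans_le hs.1
    have := hanti hsy hs0 hs.1
    simp only at this
    rwa [div_le_iff₀ hs0] at this
  have lower : κ / 2 * (y - x) ≤ ∫ s in √x..√y, T s / (s * (1 + T s)) := by
    rw [← lin x y hx hy.le]
    refine intervalIntegral.integral_mono_on hsxy (ilin _ _) (hi (Real.sqrt_nonneg _) hsy.le)
      fun s hs => ?_
    rcases eq_or_lt_of_le ((Real.sqrt_nonneg x).trans hs.1) with h | hs0
    · simp [← h]
    · have := hanti hs0 hsy hs.2
      simp only at this
      rwa [le_div_iff₀ hs0] at this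
  exact ((div_le_iff₀ (by linarith)).mpr upper).trans ((le_div_iff₀ (by linarith)).mpr lower)

theorem antitoneOn_exp_neg_integral (hr : -1 < r) (hT : ∀ x, 0 < x → 0 ≤ T x)
    (hTa : AntitoneOn (fun x => T x / x ^ 2) (Ioi 0))
    (hTC : ∀ x, 0 < x → T x ≤ C * x ^ (1 + r)) :
    AntitoneOn (fun x => Real.exp (-∫ y in (0:ℝ)..|x|, T y / (y * (1 + T y)))) (Ici 0) := by
  intro x hx y hy hxy
  have hx : 0 ≤ x := hx
  have hy : 0 ≤ y := hy
  simp only [abs_of_nonneg hx, abs_of_nonneg hy]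
  refine Real.exp_le_exp.mpr (neg_le_neg ?_)
  rw [← sub_nonneg, intervalIntegral.integral_interval_sub_left
    (intervalIntegrable_div_mul_one_add hr hT hTa hTC le_rfl hy)
    (intervalIntegrable_div_mul_one_add hr hT hTa hTC le_rfl hx)]
  refine intervalIntegral.integral_nonneg hxy fun s hs => ?_
  rcases eq_or_lt_of_le (hx.trans hs.1) with h | hs0
  · simp [← h]
  · have := hT s hs0
    positivity

theorem convexOn_exp_neg_integral_sqrt (hr : -1 < r) (hT : ∀ x, 0 < x → 0 ≤ T x)
    (hTa : AntitoneOn (fun x => T x / x ^ 2) (Ioi 0))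
    (hTC : ∀ x, 0 < x → T x ≤ C * x ^ (1 + r)) :
    ConvexOn ℝ (Ici 0)
      (fun x => Real.exp (-∫ y in (0:ℝ)..|√x|, T y / (y * (1 + T y)))) := by
  have hc := (concaveOn_integral_sqrt hr hT hTa hTC).neg
  refine ⟨convex_Ici 0, fun x hx y hy a b ha hb hab => ?_⟩
  simp only [abs_of_nonneg (Real.sqrt_nonneg _)]
  exact (Real.exp_le_exp.mpr (hc.2 hx hy ha hb hab)).trans
    (convexOn_exp.2 (mem_univ _) (mem_univ _) ha hb hab)

end Exponential

theorem C0_pos {α : ℝ} (hα : α ∈ Ioo (0:ℝ) (1/2)) : 0 < C0 α := by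
  have h1 := Real.Gamma_pos_of_pos (by linarith [hα.1] : 0 < 1 + α)
  have h2 := Real.Gamma_pos_of_pos (by linarith [hα.2] : 0 < 1 - α)
  unfold C0
  have := Real.pi_pos
  positivity

theorem Tfr_eq_integral_kern {α : ℝ} {f : ℝ → ℝ} {x : ℝ} (hx : 0 < x) :
    Tfr α f x = C0 α / α * ∫ ξ in Ioi (0:ℝ), f √(ξ ^ 2) * kern (-(2 * α)) x ξ := by
  rw [Tfr, if_neg hx.ne', abs_of_pos hx]
  congr 1
  refine setIntegral_congr_fun measurableSet_Ioi fun ξ hξ => ?_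
  have hξ : 0 < ξ := hξ
  simp only [kern]
  rw [Real.sqrt_sq hξ.le]
  ring

theorem W1.antitoneOn_sqrt {α t0 δl : ℝ} {f : ℝ → ℝ} (hf : W1 α t0 δl f) :
    AntitoneOn (fun u => f √u) (Ici 0) := fun _ _ _ _ huv =>
  hf.2.2.2.2.2.1 (Real.sqrt_nonneg _) (Real.sqrt_nonneg _) (Real.sqrt_le_sqrt huv)

theorem W1.integral_nonneg {α t0 δl : ℝ} {f W : ℝ → ℝ} (hf : W1 α t0 δl f)
    (hW : IntegrableOn W (Ioi 0))
    (ht : ∀ a, 0 < a → 0 ≤ ∫ ξ in Ioi (0:ℝ), tent a (ξ ^ 2) * W ξ) :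
    0 ≤ ∫ ξ in Ioi (0:ℝ), f √(ξ ^ 2) * W ξ := by
  have hanti := hf.antitoneOn_sqrt
  obtain ⟨hc, -, -, -, h0, -, hx, -⟩ := hf
  exact integral_nonneg_of_convexOn (g := fun u => f √u) hW ht (hc.comp Real.continuous_sqrt) hx
    hanti (fun u _ => h0 _ (Real.sqrt_nonneg u))

theorem Tfr_nonneg {α t0 δl : ℝ} (hα : α ∈ Ioo (0:ℝ) (1/2)) {f : ℝ → ℝ} (hf : W1 α t0 δl f)
    {x : ℝ} (hx : 0 < x) : 0 ≤ Tfr α f x := by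
  have hr : -1 < -(2 * α) := by linarith [hα.2]
  have hr0 : -(2 * α) < 0 := by linarith [hα.1]
  rw [Tfr_eq_integral_kern hx]
  refine mul_nonneg (div_pos (C0_pos hα) hα.1).le
    (hf.integral_nonneg (integrableOn_kern hr hr0 hx) fun a ha => ?_)
  rw [integral_tent_mul_kern hr ha hx]
  have := bumpQuotient_nonneg hr hr0 (div_pos hx (Real.sqrt_pos.mpr ha))
  positivity

theorem antitoneOn_Tfr_div_sq {α t0 δl : ℝ} (hα : α ∈ Ioo (0:ℝ) (1/2)) {f : ℝ → ℝ}
    (hf : W1 α t0 δl f) : AntitoneOn (fun x => Tfr α f x / x ^ 2) (Ioi 0) := by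
  intro x hx y hy hxy
  have hx : 0 < x := hx
  have hy : 0 < y := hy
  have hr : -1 < -(2 * α) := by linarith [hα.2]
  have hr0 : -(2 * α) < 0 := by linarith [hα.1]
  have hkx := (integrableOn_kern hr hr0 hx).mul_const (x ^ 2)⁻¹
  have hky := (integrableOn_kern hr hr0 hy).mul_const (y ^ 2)⁻¹
  have split : ∀ {φ : ℝ → ℝ} {M : ℝ}, Continuous φ → (∀ u, 0 ≤ u → |φ u| ≤ M) →
      ∫ ξ in Ioi (0:ℝ), φ (ξ ^ 2) *
        (kern (-(2 * α)) x ξ * (x ^ 2)⁻¹ - kern (-(2 * α)) y ξ * (y ^ 2)⁻¹) =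
      (∫ ξ in Ioi (0:ℝ), φ (ξ ^ 2) * kern (-(2 * α)) x ξ) * (x ^ 2)⁻¹ -
        (∫ ξ in Ioi (0:ℝ), φ (ξ ^ 2) * kern (-(2 * α)) y ξ) * (y ^ 2)⁻¹ := by
    intro φ M hφ hM
    rw [← integral_mul_const, ← integral_mul_const, ← integral_sub
      ((integrableOn_bounded_mul (integrableOn_kern hr hr0 hx) hφ hM).mul_const _)
      ((integrableOn_bounded_mul (integrableOn_kern hr hr0 hy) hφ hM).mul_const _)]
    congr 1
    funext ξ
    ring
  have key := hf.integral_nonneg (hkx.sub hky) fun a ha => ?_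
  · obtain ⟨M, hM⟩ := hf.2.1
    have e := split (φ := fun u => f √u) (hf.1.comp Real.continuous_sqrt) (fun u _ => hM _)
    simp only [Pi.sub_apply] at key
    rw [e] at key
    simp only [Tfr_eq_integral_kern hx, Tfr_eq_integral_kern hy, div_eq_mul_inv _ (_ ^ 2)]
    have := mul_nonneg (div_pos (C0_pos hα) hα.1).le key
    linarith
  · have e := split (continuous_tent a) (fun u hu => by
      rw [abs_of_nonneg (tent_nonneg a u)]; exact tent_le ha.le hu)
    simp only [Pi.sub_apply]
    have hb : 0 < √a := Real.sqrt_pos.mpr ha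
    rw [e, integral_tent_mul_kern hr ha hx, integral_tent_mul_kern hr ha hy, mul_comm (x ^ 2),
      mul_comm (y ^ 2), mul_inv_cancel_right₀ (by positivity), mul_inv_cancel_right₀ (by positivity),
      ← mul_sub]
    exact mul_nonneg (by positivity) (sub_nonneg.mpr (antitoneOn_bumpQuotient hr hr0
      (div_pos hx hb) (div_pos hy hb) (div_le_div_of_nonneg_right hxy hb.le)))

theorem exists_Tfr_le {α t0 δl : ℝ} (hα : α ∈ Ioo (0:ℝ) (1/2)) {f : ℝ → ℝ}
    (hf : W1 α t0 δl f) : ∃ C : ℝ, ∀ x, 0 < x → Tfr α f x ≤ C * x ^ (1 + -(2 * α)) := by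
  have hr : -1 < -(2 * α) := by linarith [hα.2]
  have hr0 : -(2 * α) < 0 := by linarith [hα.1]
  obtain ⟨M, hM⟩ := hf.2.1
  refine ⟨C0 α / α * (M * ∫ ξ in Ioi (0:ℝ), |kern (-(2 * α)) 1 ξ|), fun x hx => ?_⟩
  rw [Tfr_eq_integral_kern hx, setIntegral_mul_kern_scale hx hx, div_self hx.ne',
    ← Real.rpow_one_add' hx.le (by linarith), mul_comm (x ^ _), ← mul_assoc]
  refine mul_le_mul_of_nonneg_right (mul_le_mul_of_nonneg_left ?_
    (div_pos (C0_pos hα) hα.1).le) (by positivity)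
  rw [← integral_const_mul]
  refine (le_abs_self _).trans ((abs_integral_le_integral_abs).trans
    (integral_mono_of_nonneg (Eventually.of_forall fun ξ => abs_nonneg _)
      ((integrableOn_kern_one hr hr0).abs.const_mul M) (Eventually.of_forall fun ξ => ?_)))
  simp only [abs_mul]
  exact mul_le_mul_of_nonneg_right (hM _) (abs_nonneg _)

/-- For every `α ∈ (0,1/2)` and `f ∈ 𝒲₁`, `ℜ_α(f)` is non-increasing on `[0,∞)`
and `x ↦ ℜ_α(f)(√x)` is convex on `[0,∞)`. -/
theorem Rfr_monotone_convex (α t0 δl : ℝ) (hα : α ∈ Ioo (0:ℝ) (1/2)) (ht0 : 1 < t0)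
    (ht1 : max (1 / C3 α) ((1 - 2*α) / (2*α * C3 α)) < t0 ^ (1/2 - α))
    (ht2 : (2:ℝ) ^ ((2:ℝ) ^ α + 2) * Real.Gamma (2 + α) * Real.Gamma (1/2 - α) /
        (3*π*α*Real.Gamma (1 - α)) < t0 ^ (1/2 + α))
    (hδl : 1/2 ≤ δl)
    (hδ1 : (2:ℝ) ^ (2*α) * Real.Gamma (2 + α) * Real.Gamma (1/2 - α) /
        (3*π*Real.Gamma (1 - α)) ≤
        Real.Gamma (δl + 1) * t0 ^ (2*α - 1) / Real.Gamma (δl + α + 1/2))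
    (hδ2 : Real.Gamma (δl + 1) * t0 ^ (2*α - 1) / Real.Gamma (δl + α + 1/2) ≤
        (2:ℝ) ^ (2*α + 1) * Real.Gamma (2 + α) * Real.Gamma (1/2 - α) /
        (3*π*Real.Gamma (1 - α)))
    (f : ℝ → ℝ) (hf : W1 α t0 δl f) :
    AntitoneOn (Rfr α f) (Ici (0:ℝ)) ∧
    ConvexOn ℝ (Ici (0:ℝ)) (fun x => Rfr α f (Real.sqrt x)) := by
  have hr : -1 < -(2 * α) := by linarith [hα.2]
  obtain ⟨C, hC⟩ := exists_Tfr_le hα hf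
  exact ⟨antitoneOn_exp_neg_integral hr (fun _ => Tfr_nonneg hα hf) (antitoneOn_Tfr_div_sq hα hf) hC,
    convexOn_exp_neg_integral_sqrt hr (fun _ => Tfr_nonneg hα hf) (antitoneOn_Tfr_div_sq hα hf) hC⟩

end GSQGhalfplane
end
end

section
/- For every α ∈ (0,1/2), every f ∈ 𝒲₁, and every x ∈ ℝ, one has ℜ_α(f)(x) ≥ (1 + (c''_{0,α}/2)·x²)^{−1/2} ≥ f_l(x); in particular the operator ℜ_α preserves the lower barrier f_l on 𝒲₁. -/
open Real MeasureTheory Set Filter BoundedContinuousFunction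

noncomputable section

namespace GSQGhalfplane

theorem one_add_rpow_isBigO_four (a : ℝ) :
    (fun t : ℝ => (1 + t) ^ a - (1 + a * t + a * (a - 1) / 2 * t ^ 2
      + a * (a - 1) * (a - 2) / 6 * t ^ 3)) =O[nhds 0] fun t => t ^ 4 := by
  have h := (Real.one_add_rpow_hasFPowerSeriesAt_zero (a := a)).isBigO_sub_partialSum_pow 4
  have h2 : (fun y : ℝ => ‖y‖ ^ 4) =O[nhds 0] fun t => t ^ 4 :=
    Asymptotics.isBigO_of_le _ fun x => by simp
  refine (h.trans h2).congr_left fun t => ?_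
  have e2 : Ring.choose a 2 = a * (a - 1) / 2 := by
    simp [Ring.choose_eq_smul, descPochhammer_succ_right, Polynomial.smeval_mul,
      Polynomial.smeval_sub]
    ring
  have e3 : Ring.choose a 3 = a * (a - 1) * (a - 2) / 6 := by
    have two : Polynomial.smeval (2 : Polynomial ℤ) a = 2 := by
      simpa using Polynomial.smeval_natCast ℤ a 2
    simp [Ring.choose_eq_smul, descPochhammer_succ_right, Polynomial.smeval_mul,
      Polynomial.smeval_sub, Nat.factorial, two]
    ring
  simp [FormalMultilinearSeries.partialSum, Finset.sum_range_succ, binomialSeries, e2, e3]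
  ring

theorem one_sub_rpow_sub_one_add_rpow_isBigO_four (a : ℝ) :
    (fun t : ℝ => (1 - t) ^ a - (1 + t) ^ a
      + (2 * a * t + a * (a - 1) * (a - 2) / 3 * t ^ 3)) =O[nhds 0] fun t => t ^ 4 := by
  have h := one_add_rpow_isBigO_four a
  have hneg : Tendsto (fun t : ℝ => -t) (nhds 0) (nhds 0) := by
    simpa using (continuous_neg.tendsto (0:ℝ))
  have h' := h.comp_tendsto hneg
  refine ((h'.congr_right (g₂ := fun t : ℝ => t ^ 4) fun t => Even.neg_pow (by decide) t).sub h).congr_left fun t => ?_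
  simp only [Function.comp, ← sub_eq_add_neg]
  ring

/-- The kernel of `𝔗_α` at `x = 1`, with `p = 2α`. -/
def unitKernel (p ξ : ℝ) : ℝ :=
  2 * p * ξ ^ (-p) - ξ * (|1 - ξ| ^ (-p) - (1 + ξ) ^ (-p))

/-- The unit kernel with the leading term of its expansion at infinity removed. -/
def reducedKernel (p ξ : ℝ) : ℝ :=
  unitKernel p ξ + p * (p + 1) * (p + 2) / 3 * ξ ^ (-p - 2)

theorem sq_mul_rpow {a b x : ℝ} (hx : 0 < x) (hb : b = 2 + a) : x ^ 2 * x ^ a = x ^ b := by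
  rw [hb, rpow_add hx, rpow_two]

theorem hasDerivAt_add_rpow (c a b x : ℝ) (hb : b = a - 1) (h : 0 < x + c) :
    HasDerivAt (fun ξ : ℝ => (ξ + c) ^ a) (a * (x + c) ^ b) x := by
  subst hb
  simpa using ((hasDerivAt_id x).add_const c).rpow_const (p := a) (Or.inl h.ne')

theorem hasDerivAt_one_sub_rpow (a b x : ℝ) (hb : b = a - 1) (h : x < 1) :
    HasDerivAt (fun ξ : ℝ => (1 - ξ) ^ a) (-(a * (1 - x) ^ b)) x := by
  subst hb
  simpa using ((hasDerivAt_id x).const_sub 1).rpow_const (p := a) (Or.inl (sub_pos.2 h).ne')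

/-- An antiderivative of `unitKernel p` on `[1, ∞)`. -/
def kernelPrimRight (p ξ : ℝ) : ℝ :=
  2 * p / (1 - p) * ξ ^ (1 - p) - (ξ * (((ξ + -1) ^ (1 - p) - (ξ + 1) ^ (1 - p)) / (1 - p))
    - ((ξ + -1) ^ (2 - p) - (ξ + 1) ^ (2 - p)) / ((1 - p) * (2 - p)))

/-- An antiderivative of `unitKernel p` on `[0, 1]`. -/
def kernelPrimLeft (p ξ : ℝ) : ℝ :=
  2 * p / (1 - p) * ξ ^ (1 - p) - (ξ * ((-(1 - ξ) ^ (1 - p) - (ξ + 1) ^ (1 - p)) / (1 - p))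
    - ((1 - ξ) ^ (2 - p) - (ξ + 1) ^ (2 - p)) / ((1 - p) * (2 - p)))

/-- An antiderivative of `ξ ^ 2 * reducedKernel p ξ` on `[1, ∞)`. -/
def momentPrimRight (p ξ : ℝ) : ℝ :=
  2 * p / (3 - p) * ξ ^ (3 - p) + p * (p + 1) * (p + 2) / 3 / (1 - p) * ξ ^ (1 - p)
    - (ξ ^ 3 * (((ξ + -1) ^ (1 - p) - (ξ + 1) ^ (1 - p)) / (1 - p))
      - 3 * ξ ^ 2 * (((ξ + -1) ^ (2 - p) - (ξ + 1) ^ (2 - p)) / ((1 - p) * (2 - p)))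
      + 6 * ξ * (((ξ + -1) ^ (3 - p) - (ξ + 1) ^ (3 - p)) / ((1 - p) * (2 - p) * (3 - p)))
      - 6 * (((ξ + -1) ^ (4 - p) - (ξ + 1) ^ (4 - p)) / ((1 - p) * (2 - p) * (3 - p) * (4 - p))))

/-- An antiderivative of `ξ ^ 2 * reducedKernel p ξ` on `[0, 1]`. -/
def momentPrimLeft (p ξ : ℝ) : ℝ :=
  2 * p / (3 - p) * ξ ^ (3 - p) + p * (p + 1) * (p + 2) / 3 / (1 - p) * ξ ^ (1 - p)
    - (ξ ^ 3 * ((-(1 - ξ) ^ (1 - p) - (ξ + 1) ^ (1 - p)) / (1 - p))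
      - 3 * ξ ^ 2 * (((1 - ξ) ^ (2 - p) - (ξ + 1) ^ (2 - p)) / ((1 - p) * (2 - p)))
      + 6 * ξ * ((-(1 - ξ) ^ (3 - p) - (ξ + 1) ^ (3 - p)) / ((1 - p) * (2 - p) * (3 - p)))
      - 6 * (((1 - ξ) ^ (4 - p) - (ξ + 1) ^ (4 - p)) / ((1 - p) * (2 - p) * (3 - p) * (4 - p))))

section
variable {p : ℝ} (hp : p ∈ Ioo (0:ℝ) 1)
include hp

theorem hasDerivAt_kernelPrimRight {x : ℝ} (hx : 1 < x) :
    HasDerivAt (kernelPrimRight p) (unitKernel p x) x := by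
  obtain ⟨h0, h1⟩ := hp
  have dx : ∀ a b : ℝ, b = a - 1 → HasDerivAt (fun ξ : ℝ => ξ ^ a) (a * x ^ b) x := fun a b h => by
    simpa using hasDerivAt_add_rpow 0 a b x h (by linarith)
  have dm : ∀ a b : ℝ, b = a - 1 → _ := fun a b h => hasDerivAt_add_rpow (-1) a b x h (by linarith)
  have dp : ∀ a b : ℝ, b = a - 1 → _ := fun a b h => hasDerivAt_add_rpow 1 a b x h (by linarith)
  have := ((dx (1 - p) (-p) (by ring)).const_mul (2 * p / (1 - p))).sub
    (((hasDerivAt_id x).mul (((dm (1 - p) (-p) (by ring)).sub (dp (1 - p) (-p) (by ring))).div_const (1 - p))).sub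
      (((dm (2 - p) (1 - p) (by ring)).sub (dp (2 - p) (1 - p) (by ring))).div_const ((1 - p) * (2 - p))))
  refine this.congr_deriv ?_
  have e : |1 - x| = x + -1 := by rw [abs_sub_comm, abs_of_pos (by linarith)]; ring
  simp only [unitKernel, e, id, Pi.sub_apply, add_comm 1 x]
  have h1' : 1 - p ≠ 0 := by linarith
  have h2' : 2 - p ≠ 0 := by linarith
  field_simp
  ring

theorem hasDerivAt_kernelPrimLeft {x : ℝ} (hx : x ∈ Ioo (0:ℝ) 1) :
    HasDerivAt (kernelPrimLeft p) (unitKernel p x) x := by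
  obtain ⟨h0, h1⟩ := hp
  obtain ⟨hx0, hx1⟩ := hx
  have dx : ∀ a b : ℝ, b = a - 1 → HasDerivAt (fun ξ : ℝ => ξ ^ a) (a * x ^ b) x := fun a b h => by
    simpa using hasDerivAt_add_rpow 0 a b x h (by linarith)
  have dm : ∀ a b : ℝ, b = a - 1 → _ := fun a b h => hasDerivAt_one_sub_rpow a b x h hx1
  have dp : ∀ a b : ℝ, b = a - 1 → _ := fun a b h => hasDerivAt_add_rpow 1 a b x h (by linarith)
  have := ((dx (1 - p) (-p) (by ring)).const_mul (2 * p / (1 - p))).sub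
    (((hasDerivAt_id x).mul (((dm (1 - p) (-p) (by ring)).neg.sub (dp (1 - p) (-p) (by ring))).div_const (1 - p))).sub
      (((dm (2 - p) (1 - p) (by ring)).sub (dp (2 - p) (1 - p) (by ring))).div_const ((1 - p) * (2 - p))))
  refine this.congr_deriv ?_
  have e : |1 - x| = 1 - x := abs_of_pos (by linarith)
  simp only [unitKernel, e, id, Pi.sub_apply, Pi.neg_apply, add_comm 1 x]
  have h1' : 1 - p ≠ 0 := by linarith
  have h2' : 2 - p ≠ 0 := by linarith
  field_simp
  ring

theorem hasDerivAt_momentPrimRight {x : ℝ} (hx : 1 < x) :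
    HasDerivAt (momentPrimRight p) (x ^ 2 * reducedKernel p x) x := by
  obtain ⟨h0, h1⟩ := hp
  have dx : ∀ a b : ℝ, b = a - 1 → HasDerivAt (fun ξ : ℝ => ξ ^ a) (a * x ^ b) x := fun a b h => by
    simpa using hasDerivAt_add_rpow 0 a b x h (by linarith)
  have dm : ∀ a b : ℝ, b = a - 1 → _ := fun a b h => hasDerivAt_add_rpow (-1) a b x h (by linarith)
  have dp : ∀ a b : ℝ, b = a - 1 → _ := fun a b h => hasDerivAt_add_rpow 1 a b x h (by linarith)
  have d1 := ((dm (1 - p) (-p) (by ring)).sub (dp (1 - p) (-p) (by ring))).div_const (1 - p)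
  have d2 := ((dm (2 - p) (1 - p) (by ring)).sub (dp (2 - p) (1 - p) (by ring))).div_const
    ((1 - p) * (2 - p))
  have d3 := ((dm (3 - p) (2 - p) (by ring)).sub (dp (3 - p) (2 - p) (by ring))).div_const
    ((1 - p) * (2 - p) * (3 - p))
  have d4 := ((dm (4 - p) (3 - p) (by ring)).sub (dp (4 - p) (3 - p) (by ring))).div_const
    ((1 - p) * (2 - p) * (3 - p) * (4 - p))
  have := (((dx (3 - p) (2 - p) (by ring)).const_mul (2 * p / (3 - p))).add
    ((dx (1 - p) (-p) (by ring)).const_mul (p * (p + 1) * (p + 2) / 3 / (1 - p)))).sub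
    (((((hasDerivAt_pow 3 x).mul d1).sub (((hasDerivAt_pow 2 x).const_mul 3).mul d2)).add
      (((hasDerivAt_id x).const_mul 6).mul d3)).sub (d4.const_mul 6))
  refine this.congr_deriv ?_
  have e : |1 - x| = x + -1 := by rw [abs_sub_comm, abs_of_pos (by linarith)]; ring
  have ex : x ^ 2 * x ^ (-p) = x ^ (2 - p) := sq_mul_rpow (by linarith) (by ring)
  have ex2 : x ^ 2 * x ^ (-p - 2) = x ^ (-p) := sq_mul_rpow (by linarith) (by ring)
  have : x ^ 2 * reducedKernel p x = 2 * p * x ^ (2 - p) + p * (p + 1) * (p + 2) / 3 * x ^ (-p)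
      - x ^ 3 * ((x + -1) ^ (-p) - (x + 1) ^ (-p)) := by
    simp only [reducedKernel, unitKernel, e, add_comm 1 x, ← ex]
    linear_combination (p * (p + 1) * (p + 2) / 3) * ex2
  rw [this]
  simp only [id, Pi.sub_apply]
  have h1' : 1 - p ≠ 0 := by linarith
  have h2' : 2 - p ≠ 0 := by linarith
  have h3' : 3 - p ≠ 0 := by linarith
  have h4' : 4 - p ≠ 0 := by linarith
  push_cast
  field_simp
  ring

theorem hasDerivAt_momentPrimLeft {x : ℝ} (hx : x ∈ Ioo (0:ℝ) 1) :
    HasDerivAt (momentPrimLeft p) (x ^ 2 * reducedKernel p x) x := by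
  obtain ⟨h0, h1⟩ := hp
  obtain ⟨hx0, hx1⟩ := hx
  have dx : ∀ a b : ℝ, b = a - 1 → HasDerivAt (fun ξ : ℝ => ξ ^ a) (a * x ^ b) x := fun a b h => by
    simpa using hasDerivAt_add_rpow 0 a b x h (by linarith)
  have dm : ∀ a b : ℝ, b = a - 1 → _ := fun a b h => hasDerivAt_one_sub_rpow a b x h hx1
  have dp : ∀ a b : ℝ, b = a - 1 → _ := fun a b h => hasDerivAt_add_rpow 1 a b x h (by linarith)
  have d1 := ((dm (1 - p) (-p) (by ring)).neg.sub (dp (1 - p) (-p) (by ring))).div_const (1 - p)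
  have d2 := ((dm (2 - p) (1 - p) (by ring)).sub (dp (2 - p) (1 - p) (by ring))).div_const
    ((1 - p) * (2 - p))
  have d3 := ((dm (3 - p) (2 - p) (by ring)).neg.sub (dp (3 - p) (2 - p) (by ring))).div_const
    ((1 - p) * (2 - p) * (3 - p))
  have d4 := ((dm (4 - p) (3 - p) (by ring)).sub (dp (4 - p) (3 - p) (by ring))).div_const
    ((1 - p) * (2 - p) * (3 - p) * (4 - p))
  have := (((dx (3 - p) (2 - p) (by ring)).const_mul (2 * p / (3 - p))).add
    ((dx (1 - p) (-p) (by ring)).const_mul (p * (p + 1) * (p + 2) / 3 / (1 - p)))).sub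
    (((((hasDerivAt_pow 3 x).mul d1).sub (((hasDerivAt_pow 2 x).const_mul 3).mul d2)).add
      (((hasDerivAt_id x).const_mul 6).mul d3)).sub (d4.const_mul 6))
  refine this.congr_deriv ?_
  have e : |1 - x| = 1 - x := abs_of_pos (by linarith)
  have ex : x ^ 2 * x ^ (-p) = x ^ (2 - p) := sq_mul_rpow (by linarith) (by ring)
  have ex2 : x ^ 2 * x ^ (-p - 2) = x ^ (-p) := sq_mul_rpow (by linarith) (by ring)
  have : x ^ 2 * reducedKernel p x = 2 * p * x ^ (2 - p) + p * (p + 1) * (p + 2) / 3 * x ^ (-p)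
      - x ^ 3 * ((1 - x) ^ (-p) - (x + 1) ^ (-p)) := by
    simp only [reducedKernel, unitKernel, e, add_comm 1 x, ← ex]
    linear_combination (p * (p + 1) * (p + 2) / 3) * ex2
  rw [this]
  simp only [id, Pi.sub_apply, Pi.neg_apply]
  have h1' : 1 - p ≠ 0 := by linarith
  have h2' : 2 - p ≠ 0 := by linarith
  have h3' : 3 - p ≠ 0 := by linarith
  have h4' : 4 - p ≠ 0 := by linarith
  push_cast
  field_simp
  ring

omit hp in
theorem tendsto_rpow_mul_comp_inv {h : ℝ → ℝ} {n : ℕ} {a : ℝ} (hn : a < n)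
    (hh : h =O[nhds 0] fun t => t ^ n) :
    Tendsto (fun ξ : ℝ => ξ ^ a * h ξ⁻¹) atTop (nhds 0) := by
  have h1 := hh.comp_tendsto tendsto_inv_atTop_zero
  have h2 := (Asymptotics.isBigO_refl (fun ξ : ℝ => ξ ^ a) atTop).mul h1
  refine h2.trans_tendsto ?_
  have h3 := tendsto_rpow_neg_atTop (sub_pos.2 hn)
  refine h3.congr' ?_
  filter_upwards [eventually_gt_atTop 0] with ξ hξ
  simp only [Function.comp, inv_pow]
  rw [← rpow_natCast, ← rpow_neg hξ.le, ← rpow_add hξ]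
  congr 1; ring

omit hp in
theorem add_rpow_eq_rpow_mul {a c x : ℝ} (hx : 1 < x) (hc : |c| ≤ 1) :
    (x + c) ^ a = x ^ a * (1 + c * x⁻¹) ^ a := by
  have := (abs_le.1 hc).1
  have hx0 : 0 < x := by linarith
  have hx' : 1 + c * x⁻¹ = (x + c) / x := by field_simp
  rw [hx', ← mul_rpow hx0.le (div_nonneg (by linarith) hx0.le)]
  congr 1; field_simp

omit hp in
theorem sub_one_rpow_sub_add_one_rpow {a x : ℝ} (hx : 1 < x) :
    (x + -1) ^ a - (x + 1) ^ a = x ^ a * ((1 - x⁻¹) ^ a - (1 + x⁻¹) ^ a) := by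
  rw [add_rpow_eq_rpow_mul hx (by simp), add_rpow_eq_rpow_mul hx (by simp)]
  rw [neg_one_mul, one_mul, ← sub_eq_add_neg]; ring

theorem tendsto_kernelPrimRight : Tendsto (kernelPrimRight p) atTop (nhds 0) := by
  obtain ⟨h0, h1⟩ := hp
  have h1' : 1 - p ≠ 0 := by linarith
  have h2' : 2 - p ≠ 0 := by linarith
  have b := one_sub_rpow_sub_one_add_rpow_isBigO_four
  have t42 : (fun t : ℝ => t ^ 4) =O[nhds 0] fun t => t ^ 3 :=
    (Asymptotics.isLittleO_pow_pow (by norm_num)).isBigO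
  have t33 : (fun t : ℝ => t ^ 3) =O[nhds 0] fun t => t ^ 3 := Asymptotics.isBigO_refl _ _
  have key := (((((b (2 - p)).trans t42).const_mul_left (1 / ((1 - p) * (2 - p))))).sub
    ((((b (1 - p)).trans t42).const_mul_left (1 / (1 - p))))).add
    (t33.const_mul_left ((1 - p - 1) * (1 - p - 2) / 3 -
      (2 - p - 1) * (2 - p - 2) / (3 * (1 - p))))
  refine (tendsto_rpow_mul_comp_inv (a := 2 - p) (by push_cast; linarith) key).congr' ?_
  filter_upwards [eventually_gt_atTop 1] with x hx
  have hx0 : 0 < x := by linarith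
  simp only [kernelPrimRight, sub_one_rpow_sub_add_one_rpow hx]
  have e1 : x ^ (2 - p) = x * x ^ (1 - p) := by
    conv_rhs => rw [← rpow_one_add' hx0.le (by linarith)]
    congr 1; ring
  rw [e1]
  field_simp
  ring

theorem tendsto_momentPrimRight : Tendsto (momentPrimRight p) atTop (nhds 0) := by
  obtain ⟨h0, h1⟩ := hp
  have h1' : 1 - p ≠ 0 := by linarith
  have h2' : 2 - p ≠ 0 := by linarith
  have h3' : 3 - p ≠ 0 := by linarith
  have h4' : 4 - p ≠ 0 := by linarith
  have b := one_sub_rpow_sub_one_add_rpow_isBigO_four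
  have key := ((((b (1 - p)).const_mul_left (-1 / (1 - p))).add
    ((b (2 - p)).const_mul_left (3 / ((1 - p) * (2 - p))))).sub
    ((b (3 - p)).const_mul_left (6 / ((1 - p) * (2 - p) * (3 - p))))).add
    ((b (4 - p)).const_mul_left (6 / ((1 - p) * (2 - p) * (3 - p) * (4 - p))))
  refine (tendsto_rpow_mul_comp_inv (a := 4 - p) (by push_cast; linarith) key).congr' ?_
  filter_upwards [eventually_gt_atTop 1] with x hx
  have hx0 : 0 < x := by linarith
  simp only [momentPrimRight, sub_one_rpow_sub_add_one_rpow hx]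
  have e1 : x ^ (2 - p) = x * x ^ (1 - p) := by
    conv_rhs => rw [← rpow_one_add' hx0.le (by linarith)]
    congr 1; ring
  have e2 : x ^ (3 - p) = x * (x * x ^ (1 - p)) := by
    rw [← e1, ← rpow_one_add' hx0.le (by linarith)]
    congr 1; ring
  have e3 : x ^ (4 - p) = x * (x * (x * x ^ (1 - p))) := by
    rw [← e2, ← rpow_one_add' hx0.le (by linarith)]
    congr 1; ring
  rw [e3, e2, e1]
  field_simp
  ring

omit hp in
theorem nonneg_of_hasDerivAt_nonneg_s11 {F F' : ℝ → ℝ} (h0 : F 0 = 0)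
    (hd : ∀ t ∈ Ico (0:ℝ) 1, HasDerivAt F (F' t) t) (hF : ∀ t ∈ Ico (0:ℝ) 1, 0 ≤ F' t) :
    ∀ t ∈ Ico (0:ℝ) 1, 0 ≤ F t := by
  intro t ht
  have hm : MonotoneOn F (Ico 0 1) := by
    refine monotoneOn_of_deriv_nonneg (convex_Ico 0 1)
      (fun x hx => (hd x hx).continuousAt.continuousWithinAt)
      (fun x hx => (hd x (interior_subset hx)).differentiableAt.differentiableWithinAt)
      fun x hx => ?_
    rw [(hd x (interior_subset hx)).deriv]
    exact hF x (interior_subset hx)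
  rw [← h0]
  exact hm (by simp) ht ht.1

omit hp in
theorem two_le_one_sub_rpow_add_one_add_rpow {q t : ℝ} (hq : q ≤ 0) (ht : t ∈ Ico (0:ℝ) 1) :
    2 ≤ (1 - t) ^ q + (1 + t) ^ q := by
  obtain ⟨h0, h1⟩ := ht
  have hm : (0:ℝ) < 1 - t := by linarith
  have h : 1 ≤ (1 - t) ^ q * (1 + t) ^ q := by
    rw [← mul_rpow hm.le (by linarith)]
    exact one_le_rpow_of_pos_of_le_one_of_nonpos (by nlinarith) (by nlinarith) hq
  nlinarith [rpow_pos_of_pos hm q, rpow_pos_of_pos (by linarith : 0 < 1 + t) q,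
    sq_nonneg ((1 - t) ^ q - (1 + t) ^ q)]

theorem le_one_sub_rpow_sub_one_add_rpow {t : ℝ} (ht : t ∈ Ico (0:ℝ) 1) :
    2 * p * t + p * (p + 1) * (p + 2) / 3 * t ^ 3 ≤ (1 - t) ^ (-p) - (1 + t) ^ (-p) := by
  obtain ⟨h0, h1⟩ := hp
  have dm : ∀ a b : ℝ, b = a - 1 → ∀ t ∈ Ico (0:ℝ) 1,
    HasDerivAt (fun ξ : ℝ => (1 - ξ) ^ a) (-(a * (1 - t) ^ b)) t :=
    fun a b h t ht => hasDerivAt_one_sub_rpow a b t h ht.2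
  have dp : ∀ a b : ℝ, b = a - 1 → ∀ t ∈ Ico (0:ℝ) 1,
    HasDerivAt (fun ξ : ℝ => (1 + ξ) ^ a) (a * (1 + t) ^ b) t := fun a b h t ht => by
    simpa only [add_comm (1:ℝ)] using hasDerivAt_add_rpow 1 a b t h (by linarith [ht.1])
  have s3 : ∀ t ∈ Ico (0:ℝ) 1, 0 ≤ (1 - t) ^ (-p - 3) + (1 + t) ^ (-p - 3) - 2 := fun t ht =>
    sub_nonneg.2 (two_le_one_sub_rpow_add_one_add_rpow (by linarith) ht)
  have s2 : ∀ t ∈ Ico (0:ℝ) 1, 0 ≤ (1 - t) ^ (-p - 2) - (1 + t) ^ (-p - 2) - 2 * (p + 2) * t := by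
    refine nonneg_of_hasDerivAt_nonneg_s11 (by simp) (fun t ht =>
      ((dm (-p - 2) (-p - 3) (by ring) t ht).sub (dp (-p - 2) (-p - 3) (by ring) t ht)).sub
        ((hasDerivAt_id t).const_mul (2 * (p + 2)))) fun t ht => ?_
    have := mul_nonneg (by linarith : 0 ≤ p + 2) (s3 t ht)
    linarith
  have s1 : ∀ t ∈ Ico (0:ℝ) 1,
      0 ≤ (1 - t) ^ (-p - 1) + (1 + t) ^ (-p - 1) - 2 - (p + 1) * (p + 2) * t ^ 2 := by
    refine nonneg_of_hasDerivAt_nonneg_s11 (by norm_num) (fun t ht =>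
      (((dm (-p - 1) (-p - 2) (by ring) t ht).add (dp (-p - 1) (-p - 2) (by ring) t ht)).sub_const
        2).sub ((hasDerivAt_pow 2 t).const_mul ((p + 1) * (p + 2)))) fun t ht => ?_
    have := mul_nonneg (by linarith : 0 ≤ p + 1) (s2 t ht)
    norm_num
    linarith
  have s0 : ∀ t ∈ Ico (0:ℝ) 1,
      0 ≤ (1 - t) ^ (-p) - (1 + t) ^ (-p) - 2 * p * t - p * (p + 1) * (p + 2) / 3 * t ^ 3 := by
    refine nonneg_of_hasDerivAt_nonneg_s11 (by simp) (fun t ht =>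
      (((dm (-p) (-p - 1) (by ring) t ht).sub (dp (-p) (-p - 1) (by ring) t ht)).sub
        ((hasDerivAt_id t).const_mul (2 * p))).sub
        ((hasDerivAt_pow 3 t).const_mul (p * (p + 1) * (p + 2) / 3))) fun t ht => ?_
    have := mul_nonneg h0.le (s1 t ht)
    norm_num
    linarith
  linarith [s0 t ht]

theorem reducedKernel_nonpos {x : ℝ} (hx : 1 < x) : reducedKernel p x ≤ 0 := by
  have hx0 : 0 < x := by linarith
  have h := le_one_sub_rpow_sub_one_add_rpow hp (t := x⁻¹)
    ⟨by positivity, inv_lt_one_of_one_lt₀ hx⟩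
  have e : |1 - x| = x + -1 := by rw [abs_sub_comm, abs_of_pos (by linarith)]; ring
  have e2 : x ^ 2 * x ^ (-p - 2) = x ^ (-p) := sq_mul_rpow hx0 (by ring)
  have e3 := sub_one_rpow_sub_add_one_rpow (a := -p) hx
  have e4 : x ^ (-p - 2) = x ^ (-p) * (x⁻¹) ^ 2 := by rw [← e2]; field_simp
  rw [reducedKernel, unitKernel, e, add_comm 1 x, e3, e4]
  have := mul_le_mul_of_nonneg_left h (by positivity : 0 ≤ x * x ^ (-p))
  have e5 : x * x ^ (-p) * (2 * p * x⁻¹ + p * (p + 1) * (p + 2) / 3 * x⁻¹ ^ 3) =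
    2 * p * x ^ (-p) + p * (p + 1) * (p + 2) / 3 * (x ^ (-p) * x⁻¹ ^ 2) := by field_simp
  linarith

theorem unitKernel_nonpos {x : ℝ} (hx : 1 < x) : unitKernel p x ≤ 0 := by
  have h := reducedKernel_nonpos hp hx
  obtain ⟨h0, h1⟩ := hp
  have : 0 ≤ p * (p + 1) * (p + 2) / 3 * x ^ (-p - 2) :=
    mul_nonneg (by positivity) (rpow_nonneg (by linarith) _)
  rw [reducedKernel] at h
  linarith

theorem continuous_kernelPrimRight : Continuous (kernelPrimRight p) := by
  obtain ⟨h0, h1⟩ := hp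
  unfold kernelPrimRight
  fun_prop (disch := linarith)

theorem continuous_kernelPrimLeft : Continuous (kernelPrimLeft p) := by
  obtain ⟨h0, h1⟩ := hp
  unfold kernelPrimLeft
  fun_prop (disch := linarith)

theorem continuous_momentPrimRight : Continuous (momentPrimRight p) := by
  obtain ⟨h0, h1⟩ := hp
  unfold momentPrimRight
  fun_prop (disch := linarith)

theorem continuous_momentPrimLeft : Continuous (momentPrimLeft p) := by
  obtain ⟨h0, h1⟩ := hp
  unfold momentPrimLeft
  fun_prop (disch := linarith)

theorem intervalIntegrable_abs_one_sub_rpow :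
    IntervalIntegrable (fun ξ : ℝ => |1 - ξ| ^ (-p)) volume 0 1 := by
  have h : IntervalIntegrable (fun ξ : ℝ => ξ ^ (-p)) volume 0 1 :=
    intervalIntegral.intervalIntegrable_rpow' (by linarith [hp.2])
  have h2 := (h.comp_sub_left 1).symm
  simp only [sub_zero, sub_self] at h2
  refine h2.congr fun x hx => ?_
  rw [uIoc_of_le zero_le_one] at hx
  rw [abs_of_nonneg (by linarith [hx.2])]

theorem intervalIntegrable_unitKernel : IntervalIntegrable (unitKernel p) volume 0 1 := by
  have h : IntervalIntegrable (fun ξ : ℝ => ξ ^ (-p)) volume 0 1 :=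
    intervalIntegral.intervalIntegrable_rpow' (by linarith [hp.2])
  have h3 : ContinuousOn (fun ξ : ℝ => (1 + ξ) ^ (-p)) (uIcc 0 1) := by
    rw [uIcc_of_le zero_le_one]
    exact ContinuousOn.rpow_const (by fun_prop) fun x hx => Or.inl (by linarith [hx.1])
  exact (h.const_mul (2 * p)).sub
    (((intervalIntegrable_abs_one_sub_rpow hp).sub h3.intervalIntegrable).continuousOn_mul
      continuousOn_id)

theorem intervalIntegrable_sq_mul_reducedKernel :
    IntervalIntegrable (fun ξ => ξ ^ 2 * reducedKernel p ξ) volume 0 1 := by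
  have h : IntervalIntegrable (fun ξ : ℝ => ξ ^ (-p)) volume 0 1 :=
    intervalIntegral.intervalIntegrable_rpow' (by linarith [hp.2])
  have h1 := (intervalIntegrable_unitKernel hp).continuousOn_mul (continuousOn_pow 2)
  refine (h1.add (h.const_mul (p * (p + 1) * (p + 2) / 3))).congr fun x hx => ?_
  rw [uIoc_of_le zero_le_one] at hx
  have e2 : x ^ 2 * x ^ (-p - 2) = x ^ (-p) := sq_mul_rpow hx.1 (by ring)
  simp only [reducedKernel, ← e2]
  ring

omit hp in
theorem integral_Ioi_zero_of_hasDerivAt {k L R : ℝ → ℝ} (hint : IntervalIntegrable k volume 0 1)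
    (hL : Continuous L) (hR : Continuous R) (hL' : ∀ x ∈ Ioo (0:ℝ) 1, HasDerivAt L (k x) x)
    (hR' : ∀ x, 1 < x → HasDerivAt R (k x) x) (hk : ∀ x, 1 < x → k x ≤ 0)
    (hlim : Tendsto R atTop (nhds 0)) (hL0 : L 0 = 0) (hLR : L 1 = R 1) :
    IntegrableOn k (Ioi 0) ∧ ∫ x in Ioi 0, k x = 0 := by
  have i1 : IntegrableOn k (Ioc 0 1) := (intervalIntegrable_iff_integrableOn_Ioc_of_le zero_le_one).1 hint
  have i2 : IntegrableOn k (Ioi 1) :=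
    integrableOn_Ioi_deriv_of_nonpos hR.continuousWithinAt hR' hk hlim
  have e1 := intervalIntegral.integral_eq_sub_of_hasDerivAt_of_le zero_le_one hL.continuousOn hL' hint
  have e2 := integral_Ioi_of_hasDerivAt_of_nonpos hR.continuousWithinAt hR' hk hlim
  rw [intervalIntegral.integral_of_le zero_le_one] at e1
  rw [← Ioc_union_Ioi_eq_Ioi zero_le_one]
  refine ⟨i1.union i2, ?_⟩
  rw [setIntegral_union (Ioc_disjoint_Ioi le_rfl) measurableSet_Ioi i1 i2, e1, e2]
  linarith

theorem integral_unitKernel :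
    IntegrableOn (unitKernel p) (Ioi 0) ∧ ∫ x in Ioi 0, unitKernel p x = 0 := by
  refine integral_Ioi_zero_of_hasDerivAt (intervalIntegrable_unitKernel hp)
    (continuous_kernelPrimLeft hp) (continuous_kernelPrimRight hp)
    (fun x hx => hasDerivAt_kernelPrimLeft hp hx) (fun x hx => hasDerivAt_kernelPrimRight hp hx)
    (fun x hx => unitKernel_nonpos hp hx) (tendsto_kernelPrimRight hp) ?_ ?_ <;>
  obtain ⟨h0, h1⟩ := hp
  · simp [kernelPrimLeft, zero_rpow (by linarith : 1 - p ≠ 0)]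
  · simp [kernelPrimLeft, kernelPrimRight, zero_rpow (by linarith : 1 - p ≠ 0),
      zero_rpow (by linarith : 2 - p ≠ 0)]

theorem integral_sq_mul_reducedKernel :
    IntegrableOn (fun x => x ^ 2 * reducedKernel p x) (Ioi 0) ∧
      ∫ x in Ioi 0, x ^ 2 * reducedKernel p x = 0 := by
  refine integral_Ioi_zero_of_hasDerivAt (intervalIntegrable_sq_mul_reducedKernel hp)
    (continuous_momentPrimLeft hp) (continuous_momentPrimRight hp)
    (fun x hx => hasDerivAt_momentPrimLeft hp hx) (fun x hx => hasDerivAt_momentPrimRight hp hx)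
    (fun x hx => mul_nonpos_of_nonneg_of_nonpos (sq_nonneg x) (reducedKernel_nonpos hp hx))
    (tendsto_momentPrimRight hp) ?_ ?_ <;>
  obtain ⟨h0, h1⟩ := hp
  · simp [momentPrimLeft, zero_rpow (by linarith : 1 - p ≠ 0), zero_rpow (by linarith : 3 - p ≠ 0)]
  · simp [momentPrimLeft, momentPrimRight, zero_rpow (by linarith : 1 - p ≠ 0),
      zero_rpow (by linarith : 2 - p ≠ 0), zero_rpow (by linarith : 3 - p ≠ 0),
      zero_rpow (by linarith : 4 - p ≠ 0)]

theorem antitoneOn_unitKernel : AntitoneOn (unitKernel p) (Ioo 0 1) := by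
  obtain ⟨h0, h1⟩ := hp
  intro x hx y hy hxy
  have e : ∀ {z : ℝ}, z ∈ Ioo (0:ℝ) 1 → |1 - z| = 1 - z := fun hz => abs_of_pos (by linarith [hz.2])
  rw [unitKernel, unitKernel, e hx, e hy]
  have a1 : y ^ (-p) ≤ x ^ (-p) := rpow_le_rpow_of_nonpos hx.1 hxy (by linarith)
  have a2 : (1 - x) ^ (-p) ≤ (1 - y) ^ (-p) :=
    rpow_le_rpow_of_nonpos (by linarith [hy.2]) (by linarith) (by linarith)
  have a3 : (1 + y) ^ (-p) ≤ (1 + x) ^ (-p) :=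
    rpow_le_rpow_of_nonpos (by linarith [hx.1]) (by linarith) (by linarith)
  have a4 : (1 + x) ^ (-p) ≤ (1 - x) ^ (-p) :=
    rpow_le_rpow_of_nonpos (by linarith [hx.2]) (by linarith [hx.1]) (by linarith)
  have := mul_le_mul hxy (sub_le_sub a2 a3) (sub_nonneg.2 a4) hy.1.le
  nlinarith

theorem antitoneOn_reducedKernel : AntitoneOn (reducedKernel p) (Ioo 0 1) := by
  intro x hx y hy hxy
  have h := antitoneOn_unitKernel hp hx hy hxy
  obtain ⟨h0, h1⟩ := hp
  have a1 : y ^ (-p - 2) ≤ x ^ (-p - 2) := rpow_le_rpow_of_nonpos hx.1 hxy (by linarith)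
  have := mul_le_mul_of_nonneg_left a1 (by positivity : 0 ≤ p * (p + 1) * (p + 2) / 3)
  simp only [reducedKernel]
  linarith

theorem exists_unitKernel_nonneg : ∃ s ∈ Ioo (0:ℝ) 1, 0 ≤ unitKernel p s := by
  obtain ⟨h0, h1⟩ := hp
  have hs2 : √(p / 2) ^ 2 = p / 2 := sq_sqrt (by linarith)
  have hs0 : 0 < √(p / 2) := sqrt_pos.2 (by linarith)
  generalize √(p / 2) = s at hs2 hs0
  have hs1 : s < 1 := by nlinarith
  refine ⟨s, ⟨hs0, hs1⟩, ?_⟩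
  have a1 : 1 ≤ s ^ (-p) := one_le_rpow_of_pos_of_le_one_of_nonpos hs0 hs1.le (by linarith)
  have a2 : (1 - s) ^ (-p) ≤ (1 - s)⁻¹ := by
    rw [← rpow_neg_one]
    exact rpow_le_rpow_of_exponent_ge (by linarith) (by linarith) (by linarith)
  have a3 : (1 + s)⁻¹ ≤ (1 + s) ^ (-p) := by
    rw [← rpow_neg_one]
    exact rpow_le_rpow_of_exponent_le (by linarith) (by linarith)
  have a4 : s * ((1 - s)⁻¹ - (1 + s)⁻¹) ≤ 2 * p := by
    have h1 : 0 < 1 - s := by linarith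
    have h2 : 0 < 1 + s := by linarith
    have : s * ((1 - s)⁻¹ - (1 + s)⁻¹) = 2 * s ^ 2 / (1 - s ^ 2) := by
      rw [show 1 - s ^ 2 = (1 - s) * (1 + s) by ring]; field_simp; ring
    rw [this, hs2, div_le_iff₀ (by linarith)]
    nlinarith
  rw [unitKernel, abs_of_pos (by linarith)]
  have := mul_le_mul_of_nonneg_left (sub_le_sub a2 a3) hs0.le
  nlinarith

theorem exists_reducedKernel_nonneg : ∃ s ∈ Ioo (0:ℝ) 1, 0 ≤ reducedKernel p s := by
  obtain ⟨s, hs, h⟩ := exists_unitKernel_nonneg hp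
  obtain ⟨h0, h1⟩ := hp
  exact ⟨s, hs, add_nonneg h (mul_nonneg (by positivity) (rpow_nonneg hs.1.le _))⟩

omit hp in
theorem exists_sign_threshold {N : ℝ → ℝ} (hN : AntitoneOn N (Ioo 0 1))
    (hneg : ∀ x, 1 < x → N x ≤ 0) (hpos : ∃ s ∈ Ioo (0:ℝ) 1, 0 ≤ N s) :
    ∃ c > 0, ∀ x > 0, x ≠ 1 → (x < c → 0 ≤ N x) ∧ (c < x → N x ≤ 0) := by
  obtain ⟨s, hs, hNs⟩ := hpos
  set S : Set ℝ := {x | x ∈ Ioo (0:ℝ) 1 ∧ 0 ≤ N x}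
  have hb : BddAbove S := ⟨1, fun x hx => hx.1.2.le⟩
  have hsS : s ∈ S := ⟨hs, hNs⟩
  refine ⟨sSup S, hs.1.trans_le (le_csSup hb hsS), fun x hx hx1 => ⟨fun h => ?_, fun h => ?_⟩⟩
  · obtain ⟨u, hu, hxu⟩ := exists_lt_of_lt_csSup ⟨s, hsS⟩ h
    exact hu.2.trans (hN ⟨hx, hxu.trans hu.1.2⟩ hu.1 hxu.le)
  · rcases lt_or_gt_of_ne hx1 with h1 | h1
    · by_contra! hc
      exact h.not_ge (le_csSup hb ⟨⟨hx, h1⟩, hc.le⟩)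
    · exact hneg x h1

omit hp in
/-- An antitone weight against a kernel of vanishing integral that changes sign once, from
positive to negative, has a nonnegative integral. -/
theorem integral_mul_nonneg_of_sign_change {φ k : ℝ → ℝ} (hφ : AntitoneOn φ (Ioi 0))
    (hk : IntegrableOn k (Ioi 0)) (hk0 : ∫ x in Ioi 0, k x = 0)
    (hφk : IntegrableOn (fun x => φ x * k x) (Ioi 0))
    (hs : ∃ c > 0, ∀ x > 0, x ≠ 1 → (x < c → 0 ≤ k x) ∧ (c < x → k x ≤ 0)) :
    0 ≤ ∫ x in Ioi 0, φ x * k x := by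
  obtain ⟨c, hc, h⟩ := hs
  have e : ∫ x in Ioi 0, φ x * k x = ∫ x in Ioi 0, (φ x - φ c) * k x := by
    simp only [sub_mul]
    rw [integral_sub hφk (hk.const_mul _), integral_const_mul, hk0]; simp
  rw [e]
  refine integral_nonneg_of_ae ?_
  have hne : ∀ᵐ x ∂(volume.restrict (Ioi (0:ℝ))), x ≠ 1 :=
    ae_restrict_of_ae (Measure.ae_ne volume 1)
  filter_upwards [hne, ae_restrict_mem measurableSet_Ioi] with x hx1 hx0
  obtain ⟨ha, hb⟩ := h x hx0 hx1
  rcases lt_trichotomy x c with hxc | rfl | hxc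
  · exact mul_nonneg (sub_nonneg.2 (hφ hx0 hc hxc.le)) (ha hxc)
  · simp
  · exact mul_nonneg_of_nonpos_of_nonpos (sub_nonpos.2 (hφ hc hx0 hxc.le)) (hb hxc)

theorem integral_mul_unitKernel_mem {g : ℝ → ℝ} (hg : Continuous g) (hg0 : ∀ x > 0, 0 ≤ g x)
    (hg1 : ∀ x > 0, g x ≤ 1) (hanti : AntitoneOn g (Ioi 0))
    (hconc : AntitoneOn (fun x => (1 - g x) / x ^ 2) (Ioi 0))
    (hint : IntegrableOn (fun x => (1 - g x) * x ^ (-p - 2)) (Ioi 0)) :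
    0 ≤ ∫ x in Ioi 0, g x * unitKernel p x ∧
      ∫ x in Ioi 0, g x * unitKernel p x ≤
        p * (p + 1) * (p + 2) / 3 * ∫ x in Ioi 0, (1 - g x) * x ^ (-p - 2) := by
  obtain ⟨iK, K0⟩ := integral_unitKernel hp
  obtain ⟨iN, N0⟩ := integral_sq_mul_reducedKernel hp
  have igK : IntegrableOn (fun x => g x * unitKernel p x) (Ioi 0) := by
    refine iK.bdd_mul (c := 1) hg.aestronglyMeasurable ?_
    filter_upwards [ae_restrict_mem measurableSet_Ioi] with x hx
    rw [norm_eq_abs, abs_of_nonneg (hg0 x hx)]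
    exact hg1 x hx
  refine ⟨integral_mul_nonneg_of_sign_change hanti iK K0 igK (exists_sign_threshold
    (antitoneOn_unitKernel hp) (fun x hx => unitKernel_nonpos hp hx)
    (exists_unitKernel_nonneg hp)), ?_⟩
  set A := p * (p + 1) * (p + 2) / 3 with hA
  have e : ∀ x ∈ Ioi (0:ℝ), (1 - g x) / x ^ 2 * (x ^ 2 * reducedKernel p x) =
      (unitKernel p x - g x * unitKernel p x) + A * ((1 - g x) * x ^ (-p - 2)) := fun x hx => by
    have : x ≠ 0 := (mem_Ioi.1 hx).ne'
    rw [reducedKernel, ← hA]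
    field_simp
  have hi := (iK.sub igK).add (hint.const_mul A)
  have hpos := integral_mul_nonneg_of_sign_change hconc iN N0
    (hi.congr_fun (fun x hx => (e x hx).symm) measurableSet_Ioi) <| by
      obtain ⟨c, hc, h⟩ := exists_sign_threshold (antitoneOn_reducedKernel hp)
        (fun x hx => reducedKernel_nonpos hp hx) (exists_reducedKernel_nonneg hp)
      exact ⟨c, hc, fun x hx hx1 => ⟨fun hxc => mul_nonneg (sq_nonneg x) ((h x hx hx1).1 hxc),
        fun hxc => mul_nonpos_of_nonneg_of_nonpos (sq_nonneg x) ((h x hx hx1).2 hxc)⟩⟩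
  rw [setIntegral_congr_fun measurableSet_Ioi e,
    integral_add (f := fun x => unitKernel p x - g x * unitKernel p x) (iK.sub igK)
      (hint.const_mul A), integral_sub iK igK, integral_const_mul, K0] at hpos
  linarith
end

theorem integral_Ioo_rpow_mul_one_sub_rpow {a b : ℝ} (ha : 0 < a) (hb : 0 < b) :
    ∫ x in Ioo (0:ℝ) 1, x ^ (a - 1) * (1 - x) ^ (b - 1) = ProbabilityTheory.beta a b := by
  rw [ProbabilityTheory.beta_eq_betaIntegralReal a b ha hb,
      Complex.betaIntegral, intervalIntegral.integral_of_le (by norm_num),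
      ← integral_Ioc_eq_integral_Ioo, ← RCLike.re_to_complex, ← integral_re]
  · refine setIntegral_congr_fun measurableSet_Ioc fun x ⟨hx1, hx₂⟩ ↦ ?_
    norm_cast
    rw [← Complex.ofReal_cpow, ← Complex.ofReal_cpow, RCLike.re_to_complex,
      Complex.re_mul_ofReal, Complex.ofReal_re]
    all_goals linarith
  convert! Complex.betaIntegral_convergent (u := a) (v := b) (by simpa) (by simpa)
  rw [intervalIntegrable_iff_integrableOn_Ioc_of_le (by simp), IntegrableOn]

theorem integral_Ioi_rpow_mul_one_add_sq_rpow {a b : ℝ} (ha : 0 < a) (hb : 0 < b) :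
    ∫ x in Ioi (0:ℝ), x ^ (2 * a - 1) * (1 + x ^ 2) ^ (-(a + b)) =
      ProbabilityTheory.beta a b / 2 := by
  have himage : (fun x : ℝ => x ^ 2 / (1 + x ^ 2)) '' Ioi 0 = Ioo 0 1 := by
    ext u
    constructor
    · rintro ⟨x, hx, rfl⟩
      have : 0 < x := hx
      exact ⟨by positivity, by rw [div_lt_one (by positivity)]; linarith⟩
    · rintro ⟨h0, h1⟩
      have h1' : 0 < 1 - u := by linarith
      refine ⟨√(u / (1 - u)), sqrt_pos.2 (by positivity), ?_⟩
      simp only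
      rw [sq_sqrt (by positivity)]
      field_simp
      ring
  have hinj : InjOn (fun x : ℝ => x ^ 2 / (1 + x ^ 2)) (Ioi 0) := by
    intro x hx y hy h
    have hx' : 0 < x := hx
    have hy' : 0 < y := hy
    simp only at h
    rw [div_eq_div_iff (by positivity) (by positivity)] at h
    exact (sq_eq_sq₀ hx'.le hy'.le).1 (by linarith)
  have hderiv : ∀ x ∈ Ioi (0:ℝ), HasDerivWithinAt (fun x : ℝ => x ^ 2 / (1 + x ^ 2))
      (2 * x / (1 + x ^ 2) ^ 2) (Ioi 0) x := fun x _ => by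
    have h := (hasDerivAt_pow 2 x).div ((hasDerivAt_pow 2 x).const_add 1)
      (by positivity : (1:ℝ) + x ^ 2 ≠ 0)
    refine (h.congr_deriv ?_).hasDerivWithinAt
    congr 1
    push_cast
    ring
  have h := integral_image_eq_integral_abs_deriv_smul measurableSet_Ioi hderiv hinj
    (fun u => u ^ (a - 1) * (1 - u) ^ (b - 1))
  rw [himage, integral_Ioo_rpow_mul_one_sub_rpow ha hb] at h
  rw [h, ← integral_div]
  refine setIntegral_congr_fun measurableSet_Ioi fun x hx => ?_
  have hx0 : 0 < x := hx
  have h1 : 0 < 1 + x ^ 2 := by positivity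
  have e1 : 1 - x ^ 2 / (1 + x ^ 2) = (1 + x ^ 2)⁻¹ := by field_simp; ring
  have e2 : (x ^ 2) ^ (a - 1) = x ^ (2 * (a - 1)) := by
    rw [← rpow_natCast, ← rpow_mul hx0.le]; norm_cast
  have e3 : x ^ (2 * a - 1) = x * x ^ (2 * (a - 1)) := by
    rw [show 2 * a - 1 = 1 + 2 * (a - 1) by ring, rpow_add hx0, rpow_one]
  have e4 : (1 + x ^ 2) ^ (-(a + b)) =
      ((1 + x ^ 2) ^ 2)⁻¹ * ((1 + x ^ 2) ^ (a - 1))⁻¹ * ((1 + x ^ 2) ^ (b - 1))⁻¹ := by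
    generalize 1 + x ^ 2 = w at h1
    rw [← rpow_neg h1.le, ← rpow_neg h1.le, ← rpow_two, ← rpow_neg h1.le, ← rpow_add h1,
      ← rpow_add h1]
    congr 1; ring
  simp only [smul_eq_mul]
  rw [abs_of_pos (by positivity), e1, div_rpow (by positivity) h1.le, inv_rpow h1.le, e2, e3, e4]
  field_simp

/-- The `c`-moment of the barrier `(1 + x²)^{-δ}`. -/
theorem integral_one_sub_one_add_sq_rpow {p δ : ℝ} (hp : p ∈ Ioo (0:ℝ) 1) (hδ : 0 < δ) :
    IntegrableOn (fun x : ℝ => (1 - (1 + x ^ 2) ^ (-δ)) * x ^ (-p - 2)) (Ioi 0) ∧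
    ∫ x in Ioi (0:ℝ), (1 - (1 + x ^ 2) ^ (-δ)) * x ^ (-p - 2) =
      Gamma (1 / 2 - p / 2) * Gamma (δ + p / 2 + 1 / 2) / ((1 + p) * Gamma δ) := by
  obtain ⟨h0, h1⟩ := hp
  have hb0 : ∀ x : ℝ, 0 ≤ 1 - (1 + x ^ 2) ^ (-δ) := fun x =>
    sub_nonneg.2 (rpow_le_one_of_one_le_of_nonpos (by nlinarith [sq_nonneg x]) (by linarith))
  have hb1 : ∀ x : ℝ, 1 - (1 + x ^ 2) ^ (-δ) ≤ 1 := fun x => by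
    linarith [rpow_nonneg (by positivity : 0 ≤ 1 + x ^ 2) (-δ)]
  have hb2 : ∀ x : ℝ, 1 - (1 + x ^ 2) ^ (-δ) ≤ δ * x ^ 2 := fun x => by
    have hpos : 0 < 1 + x ^ 2 := by positivity
    have h := add_one_le_exp (log (1 + x ^ 2) * (-δ))
    rw [← rpow_def_of_pos hpos] at h
    have := mul_le_mul_of_nonneg_left (log_le_sub_one_of_pos hpos) hδ.le
    linarith
  have hcont : Continuous fun x : ℝ => 1 - (1 + x ^ 2) ^ (-δ) :=
    continuous_const.sub ((by fun_prop : Continuous fun x : ℝ => 1 + x ^ 2).rpow_const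
      fun x => Or.inl (by positivity))
  have hmeas : AEStronglyMeasurable (fun x : ℝ => (1 - (1 + x ^ 2) ^ (-δ)) * x ^ (-p - 2)) :=
    hcont.aestronglyMeasurable.mul (measurable_id.pow_const _).aestronglyMeasurable
  have hint : IntegrableOn (fun x : ℝ => (1 - (1 + x ^ 2) ^ (-δ)) * x ^ (-p - 2)) (Ioi 0) := by
    rw [← Ioc_union_Ioi_eq_Ioi zero_le_one]
    refine IntegrableOn.union ?_ ?_
    · have h : IntervalIntegrable (fun ξ : ℝ => ξ ^ (-p)) volume 0 1 :=
        intervalIntegral.intervalIntegrable_rpow' (by linarith)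
      have h := ((intervalIntegrable_iff_integrableOn_Ioc_of_le zero_le_one).1 h).const_mul δ
      refine Integrable.mono' h hmeas.restrict ?_
      filter_upwards [ae_restrict_mem measurableSet_Ioc] with x hx
      have e : x ^ 2 * x ^ (-p - 2) = x ^ (-p) := sq_mul_rpow hx.1 (by ring)
      rw [norm_eq_abs, abs_of_nonneg (mul_nonneg (hb0 x) (rpow_nonneg hx.1.le _))]
      calc _ ≤ δ * x ^ 2 * x ^ (-p - 2) :=
            mul_le_mul_of_nonneg_right (hb2 x) (rpow_nonneg hx.1.le _)
        _ = δ * x ^ (-p) := by rw [mul_assoc, e]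
    · have h := integrableOn_Ioi_rpow_of_lt (by linarith : -p - 2 < -1) zero_lt_one
      refine Integrable.mono' h hmeas.restrict ?_
      filter_upwards [ae_restrict_mem measurableSet_Ioi] with x hx
      have hx0 : 0 < x := zero_lt_one.trans hx
      rw [norm_eq_abs, abs_of_nonneg (mul_nonneg (hb0 x) (rpow_nonneg hx0.le _))]
      exact mul_le_of_le_one_left (rpow_nonneg hx0.le _) (hb1 x)
  refine ⟨hint, ?_⟩
  have hβ := integral_Ioi_rpow_mul_one_add_sq_rpow (a := 1 / 2 - p / 2) (b := δ + p / 2 + 1 / 2)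
    (by linarith) (by linarith)
  have ex1 : 2 * (1 / 2 - p / 2) - 1 = -p := by ring
  have ex2 : -(1 / 2 - p / 2 + (δ + p / 2 + 1 / 2)) = -δ - 1 := by ring
  rw [ex1, ex2] at hβ
  have hβint : IntegrableOn (fun x : ℝ => x ^ (-p) * (1 + x ^ 2) ^ (-δ - 1)) (Ioi 0) := by
    refine Integrable.of_integral_ne_zero ?_
    rw [hβ]
    exact (half_pos (ProbabilityTheory.beta_pos (by linarith) (by linarith))).ne'
  have hd : ∀ x ∈ Ioi (0:ℝ), HasDerivAt
      (fun x : ℝ => (1 - (1 + x ^ 2) ^ (-δ)) * (x ^ (-p - 1) / (-p - 1)))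
      ((1 - (1 + x ^ 2) ^ (-δ)) * x ^ (-p - 2) -
        2 * δ / (1 + p) * (x ^ (-p) * (1 + x ^ 2) ^ (-δ - 1))) x := fun x hx => by
    have hx0 : 0 < x := hx
    have d1 := (((hasDerivAt_pow 2 x).const_add 1).rpow_const (p := -δ)
      (Or.inl (by positivity))).const_sub 1
    have d2 := (hasDerivAt_rpow_const (x := x) (p := -p - 1) (Or.inl hx0.ne')).div_const (-p - 1)
    refine (d1.mul d2).congr_deriv ?_
    have e1 : x * x ^ (-p - 1) = x ^ (-p) := by
      rw [← rpow_one_add' hx0.le (by linarith)]; congr 1; ring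
    have h1p : 1 + p ≠ 0 := by linarith
    have h1p' : -p - 1 ≠ 0 := by linarith
    rw [← e1, show -p - 1 - 1 = -p - 2 by ring]
    push_cast
    field_simp
    ring
  have hsub := hint.sub (hβint.const_mul (2 * δ / (1 + p)))
  have habs : ∀ x : ℝ, 0 < x → |(1 - (1 + x ^ 2) ^ (-δ)) * (x ^ (-p - 1) / (-p - 1))| =
      (1 - (1 + x ^ 2) ^ (-δ)) * x ^ (-p - 1) / (1 + p) := fun x hx => by
    rw [abs_mul, abs_of_nonneg (hb0 x), abs_div, abs_of_pos (rpow_pos_of_pos hx _),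
      abs_of_neg (by linarith : -p - 1 < 0), mul_div_assoc]
    congr 2
    ring
  have hzero : ContinuousWithinAt
      (fun x : ℝ => (1 - (1 + x ^ 2) ^ (-δ)) * (x ^ (-p - 1) / (-p - 1))) (Ici 0) 0 := by
    have hlim : Tendsto (fun x : ℝ => δ / (1 + p) * x ^ (1 - p)) (nhdsWithin 0 (Ici 0)) (nhds 0) := by
      have h : Continuous fun x : ℝ => δ / (1 + p) * x ^ (1 - p) :=
        continuous_const.mul (continuous_id.rpow_const fun x => Or.inr (by linarith))
      have h := (h.tendsto 0).mono_left (nhdsWithin_le_nhds (s := Ici 0))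
      rwa [zero_rpow (by linarith), mul_zero] at h
    rw [ContinuousWithinAt]
    simp only [ne_eq, OfNat.ofNat_ne_zero, not_false_eq_true, zero_pow, add_zero, one_rpow,
      sub_self, zero_mul]
    refine squeeze_zero_norm' ?_ hlim
    filter_upwards [self_mem_nhdsWithin] with x hx
    rcases (mem_Ici.1 hx).eq_or_lt with rfl | hx0
    · simp [zero_rpow (by linarith : 1 - p ≠ 0)]
    · have e : x ^ 2 * x ^ (-p - 1) = x ^ (1 - p) := sq_mul_rpow hx0 (by ring)
      rw [norm_eq_abs, habs x hx0, ← e, div_mul_eq_mul_div, ← mul_assoc]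
      gcongr
      exact hb2 x
  have htop : Tendsto (fun x : ℝ => (1 - (1 + x ^ 2) ^ (-δ)) * (x ^ (-p - 1) / (-p - 1)))
      atTop (nhds 0) := by
    have hlim := (tendsto_rpow_neg_atTop (by linarith : 0 < p + 1)).div_const (1 + p)
    rw [zero_div] at hlim
    refine squeeze_zero_norm' ?_ hlim
    filter_upwards [eventually_gt_atTop 0] with x hx
    rw [norm_eq_abs, habs x hx, show -(p + 1) = -p - 1 by ring]
    gcongr
    exact mul_le_of_le_one_left (rpow_nonneg hx.le _) (hb1 x)
  have hF := integral_Ioi_of_hasDerivAt_of_tendsto hzero hd hsub htop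
  simp only [ne_eq, OfNat.ofNat_ne_zero, not_false_eq_true, zero_pow, add_zero, one_rpow,
    sub_self, zero_mul] at hF
  rw [integral_sub hint (hβint.const_mul _), integral_const_mul, hβ] at hF
  rw [sub_eq_zero.1 hF, ProbabilityTheory.beta,
    show 1 / 2 - p / 2 + (δ + p / 2 + 1 / 2) = δ + 1 by ring, Gamma_add_one hδ.ne']
  have := (Gamma_pos_of_pos hδ).ne'
  field_simp

theorem antitoneOn_one_sub_div_sq {f : ℝ → ℝ} (hc : ConvexOn ℝ (Ici 0) fun x => f (√x))
    (h0 : f 0 = 1) : AntitoneOn (fun x => (1 - f x) / x ^ 2) (Ioi 0) := by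
  intro a ha b hb hab
  have ha0 : 0 < a := ha
  have hb0 : 0 < b := hb
  have ht : a ^ 2 / b ^ 2 ≤ 1 := by rw [div_le_one (by positivity)]; gcongr
  have h := hc.2 (mem_Ici.2 le_rfl) (mem_Ici.2 (sq_nonneg b)) (sub_nonneg.2 ht) (by positivity)
    (sub_add_cancel _ _)
  simp only [smul_eq_mul, mul_zero, zero_add, sqrt_zero, h0, sqrt_sq hb0.le, mul_one] at h
  rw [div_mul_cancel₀ _ (by positivity), sqrt_sq ha0.le] at h
  simp only
  rw [div_le_div_iff₀ (by positivity) (by positivity)]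
  have e : a ^ 2 / b ^ 2 * b ^ 2 = a ^ 2 := div_mul_cancel₀ _ (by positivity)
  rw [← e]
  generalize a ^ 2 / b ^ 2 = t at h
  linarith [mul_le_mul_of_nonneg_right h (sq_nonneg b)]

theorem mul_rpow_comp_mul_eq {y : ℝ} (hy : 0 < y) (h : ℝ → ℝ) (s : ℝ) :
    EqOn (fun x => h (y * x) * x ^ s) (fun x => y ^ (-s) * (h (y * x) * (y * x) ^ s)) (Ioi 0) :=
  fun x hx => by
    have hx0 : 0 < x := hx
    simp only
    rw [mul_rpow hy.le hx0.le, rpow_neg hy.le]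
    have := (rpow_pos_of_pos hy s).ne'
    field_simp

theorem integral_comp_mul_mul_rpow {y : ℝ} (hy : 0 < y) (h : ℝ → ℝ) (s : ℝ) :
    ∫ x in Ioi 0, h (y * x) * x ^ s = y ^ (-s - 1) * ∫ x in Ioi 0, h x * x ^ s := by
  rw [setIntegral_congr_fun measurableSet_Ioi (mul_rpow_comp_mul_eq hy h s), integral_const_mul,
    integral_comp_mul_left_Ioi (fun x => h x * x ^ s) 0 hy, mul_zero, smul_eq_mul, ← mul_assoc,
    rpow_sub hy, rpow_one, div_eq_mul_inv]

theorem integrableOn_comp_mul_mul_rpow_iff {y : ℝ} (hy : 0 < y) (h : ℝ → ℝ) (s : ℝ) :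
    IntegrableOn (fun x => h (y * x) * x ^ s) (Ioi 0) ↔
      IntegrableOn (fun x => h x * x ^ s) (Ioi 0) := by
  rw [integrableOn_congr_fun (mul_rpow_comp_mul_eq hy h s) measurableSet_Ioi, IntegrableOn,
    integrable_const_mul_iff (rpow_pos_of_pos hy _).ne'.isUnit]
  simpa [IntegrableOn] using integrableOn_Ioi_comp_mul_left_iff (fun x => h x * x ^ s) 0 hy

theorem Tfr_eq_integral_unitKernel (α : ℝ) (f : ℝ → ℝ) {y : ℝ} (hy : 0 < y) :
    Tfr α f y = C0 α / α * y ^ (1 - 2 * α) *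
      ∫ x in Ioi 0, f (y * x) * unitKernel (2 * α) x := by
  have h := integral_comp_mul_left_Ioi (fun ξ => f ξ * (4 * α * ξ ^ (-(2 * α)) -
    (ξ / y) * (|y - ξ| ^ (-(2 * α)) - (y + ξ) ^ (-(2 * α))))) 0 hy
  rw [mul_zero, smul_eq_mul, eq_inv_mul_iff_mul_eq₀ hy.ne'] at h
  rw [Tfr, if_neg hy.ne', abs_of_pos hy, ← h, mul_assoc, sub_eq_add_neg 1, rpow_add hy, rpow_one,
    mul_assoc y, ← integral_const_mul (y ^ (-(2 * α)))]
  congr 2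
  refine setIntegral_congr_fun measurableSet_Ioi fun x hx => ?_
  have hx0 : 0 < x := hx
  have e1 : |y - y * x| = y * |1 - x| := by
    rw [← mul_one_sub, abs_mul, abs_of_pos hy]
  have e2 : y + y * x = y * (1 + x) := by ring
  simp only [unitKernel]
  rw [e1, e2, mul_rpow hy.le hx0.le, mul_rpow hy.le (abs_nonneg _), mul_rpow hy.le (by positivity),
    mul_div_cancel_left₀ _ hy.ne']
  ring

theorem cHigh_pos {α t0 δl : ℝ} (hα : α ∈ Ioo (0:ℝ) (1/2)) (ht0 : 0 < t0) (hδl : 0 < δl) :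
    0 < cHigh α t0 δl := by
  have h0 := hα.1
  have h1 := Gamma_pos_of_pos (by linarith [hα.2] : 0 < 1 / 2 - α)
  have h2 := Gamma_pos_of_pos (by linarith : 0 < δl + α + 1 / 2)
  have h3 := Gamma_pos_of_pos hδl
  have h4 := C0_pos hα
  rw [cHigh]
  positivity

/-- The `c`-moment of the lower barrier `f_l`. -/
theorem integral_one_sub_fl {p t0 δl : ℝ} (hp : p ∈ Ioo (0:ℝ) 1) (ht0 : 0 < t0) (hδl : 0 < δl) :
    IntegrableOn (fun x : ℝ => (1 - fl t0 δl x) * x ^ (-p - 2)) (Ioi 0) ∧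
    ∫ x in Ioi (0:ℝ), (1 - fl t0 δl x) * x ^ (-p - 2) = t0 ^ (-1 - p) *
      (Gamma (1 / 2 - p / 2) * Gamma (δl + p / 2 + 1 / 2) / ((1 + p) * Gamma δl)) := by
  obtain ⟨hi, hv⟩ := integral_one_sub_one_add_sq_rpow hp hδl
  have e : ∀ x : ℝ, 1 - fl t0 δl x = 1 - (1 + (t0⁻¹ * x) ^ 2) ^ (-δl) := fun x => by
    rw [fl, inv_mul_eq_div, div_pow]
  simp only [e]
  have ht := inv_pos.2 ht0
  refine ⟨(integrableOn_comp_mul_mul_rpow_iff ht _ _).2 hi, ?_⟩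
  rw [integral_comp_mul_mul_rpow ht (fun x => 1 - (1 + x ^ 2) ^ (-δl)), hv, inv_rpow ht0.le,
    ← rpow_neg ht0.le]
  congr 2
  ring

theorem Tfr_mem {α t0 δl : ℝ} (hα : α ∈ Ioo (0:ℝ) (1/2)) (ht0 : 0 < t0) (hδl : 0 < δl)
    {f : ℝ → ℝ} (hf : W1 α t0 δl f) {y : ℝ} (hy : 0 < y) :
    0 ≤ Tfr α f y ∧ Tfr α f y ≤ cHigh α t0 δl / 2 * y ^ 2 := by
  obtain ⟨hcont, -, -, h0, hnn, hanti, hconv, hfl, -, -⟩ := hf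
  have hp : 2 * α ∈ Ioo (0:ℝ) 1 := ⟨by linarith [hα.1], by linarith [hα.2]⟩
  have hle1 : ∀ x > 0, f x ≤ 1 := fun x hx =>
    h0 ▸ hanti (mem_Ici.2 le_rfl) (mem_Ici.2 (le_of_lt hx)) hx.le
  obtain ⟨hi, hv⟩ := integral_one_sub_fl hp ht0 hδl
  have hmono : ∀ x ∈ Ioi (0:ℝ), (1 - f x) * x ^ (-(2 * α) - 2) ≤
      (1 - fl t0 δl x) * x ^ (-(2 * α) - 2) := fun x hx =>
    mul_le_mul_of_nonneg_right (by linarith [hfl x]) (rpow_nonneg (mem_Ioi.1 hx).le _)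
  have hfi : IntegrableOn (fun x => (1 - f x) * x ^ (-(2 * α) - 2)) (Ioi 0) := by
    refine Integrable.mono' hi ((continuous_const.sub hcont).aestronglyMeasurable.mul
      (measurable_id.pow_const _).aestronglyMeasurable) ?_
    filter_upwards [ae_restrict_mem measurableSet_Ioi] with x hx
    rw [norm_eq_abs, abs_of_nonneg (mul_nonneg (sub_nonneg.2 (hle1 x hx))
      (rpow_nonneg (mem_Ioi.1 hx).le _))]
    exact hmono x hx
  have hmom := setIntegral_mono_on hfi hi measurableSet_Ioi hmono
  have hmul : ∀ {x : ℝ}, 0 < x → 0 < y * x := fun hx => mul_pos hy hx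
  obtain ⟨hlow, hupp⟩ := integral_mul_unitKernel_mem hp (g := fun x => f (y * x))
    (hcont.comp (continuous_const_mul y)) (fun x hx => hnn _ (mem_Ici.2 (hmul hx).le))
    (fun x hx => hle1 _ (hmul hx))
    (fun a ha b hb hab => hanti (mem_Ici.2 (hmul ha).le) (mem_Ici.2 (hmul hb).le)
      (mul_le_mul_of_nonneg_left hab hy.le))
    (fun a ha b hb hab => by
      have h := antitoneOn_one_sub_div_sq hconv h0 (mem_Ioi.2 (hmul ha)) (mem_Ioi.2 (hmul hb))
        (mul_le_mul_of_nonneg_left hab hy.le)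
      simp only [mul_pow, div_mul_eq_div_div_swap] at h
      exact (div_le_div_iff_of_pos_right (by positivity)).1 h)
    ((integrableOn_comp_mul_mul_rpow_iff hy (fun x => 1 - f x) _).2 hfi)
  rw [integral_comp_mul_mul_rpow hy (fun x => 1 - f x)] at hupp
  have hC := C0_pos hα
  have hα0 := hα.1
  rw [Tfr_eq_integral_unitKernel α f hy]
  refine ⟨by positivity, ?_⟩
  rw [hv] at hmom
  set J := Gamma (1 / 2 - 2 * α / 2) * Gamma (δl + 2 * α / 2 + 1 / 2) / ((1 + 2 * α) * Gamma δl)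
    with hJ
  set A := 2 * α * (2 * α + 1) * (2 * α + 2) / 3 with hA
  have hA0 : 0 ≤ A := by positivity
  have ey : y ^ (1 - 2 * α) * y ^ (-(-(2 * α) - 2) - 1) = y ^ 2 := by
    rw [← rpow_add hy, ← rpow_two]; congr 1; ring
  calc _ ≤ C0 α / α * y ^ (1 - 2 * α) *
        (A * (y ^ (-(-(2 * α) - 2) - 1) * (t0 ^ (-1 - 2 * α) * J))) := by
        refine mul_le_mul_of_nonneg_left (hupp.trans ?_) (by positivity)
        gcongr
    _ = C0 α / α * A * (t0 ^ (-1 - 2 * α) * J) * y ^ 2 := by rw [← ey]; ring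
    _ = cHigh α t0 δl / 2 * y ^ 2 := by
        have hg := (Gamma_pos_of_pos hδl).ne'
        rw [cHigh, hJ, hA, mul_div_cancel_left₀ α two_ne_zero]
        field_simp
        ring

theorem integral_mul_div_one_add_mul_sq {K : ℝ} (hK : 0 ≤ K) (b : ℝ) :
    ∫ y in (0:ℝ)..b, K * y / (1 + K * y ^ 2) = log (1 + K * b ^ 2) / 2 := by
  have hne : ∀ y : ℝ, 1 + K * y ^ 2 ≠ 0 := fun y => by positivity
  rw [intervalIntegral.integral_eq_sub_of_hasDerivAt (f := fun y => log (1 + K * y ^ 2) / 2)]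
  · simp
  · intro y _
    have h := ((((hasDerivAt_pow 2 y).const_mul K).const_add 1).log (hne y)).div_const 2
    refine h.congr_deriv ?_
    have := hne y
    push_cast
    field_simp
  · exact (Continuous.div (by fun_prop) (by fun_prop) hne).intervalIntegrable _ _

theorem rpow_neg_half_le_Rfr {α K : ℝ} (hK : 0 ≤ K) {f : ℝ → ℝ}
    (hT : ∀ y > 0, 0 ≤ Tfr α f y ∧ Tfr α f y ≤ K * y ^ 2) (x : ℝ) :
    (1 + K * x ^ 2) ^ (-(1/2) : ℝ) ≤ Rfr α f x := by
  have hpos : 0 < 1 + K * x ^ 2 := by positivity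
  rw [rpow_def_of_pos hpos, Rfr, exp_le_exp, ← sq_abs x, mul_neg, neg_le_neg_iff, mul_one_div,
    ← integral_mul_div_one_add_mul_sq hK, intervalIntegral.integral_of_le (abs_nonneg x),
    intervalIntegral.integral_of_le (abs_nonneg x)]
  refine integral_mono_of_nonneg ?_ ?_ ?_
  · filter_upwards [ae_restrict_mem measurableSet_Ioc] with y hy
    have hy0 := hy.1
    have := (hT y hy0).1
    simp only [Pi.zero_apply]
    positivity
  · have h : Continuous fun y : ℝ => K * y / (1 + K * y ^ 2) :=
      Continuous.div (by fun_prop) (by fun_prop) fun y => by positivity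
    exact (h.integrableOn_Icc (a := 0) (b := |x|)).mono_set Ioc_subset_Icc_self
  · filter_upwards [ae_restrict_mem measurableSet_Ioc] with y hy
    have hy0 := hy.1
    obtain ⟨h0, h1⟩ := hT y hy0
    rw [div_le_div_iff₀ (by positivity) (by positivity)]
    nlinarith

theorem one_add_sq_div_rpow_neg_le {K t δ : ℝ} (hδ : 1 / 2 ≤ δ) (hK0 : 0 ≤ K)
    (hK : K ≤ 2 * δ / t ^ 2) (x : ℝ) : fl t δ x ≤ (1 + K * x ^ 2) ^ (-(1/2) : ℝ) := by
  have hs : 0 ≤ x ^ 2 / t ^ 2 := by positivity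
  have hb := one_add_mul_self_le_rpow_one_add (s := x ^ 2 / t ^ 2) (by linarith)
    (by linarith : 1 ≤ 2 * δ)
  have h1 : 1 + K * x ^ 2 ≤ (1 + x ^ 2 / t ^ 2) ^ (2 * δ) := by
    have := mul_le_mul_of_nonneg_right hK (sq_nonneg x)
    have e : 2 * δ / t ^ 2 * x ^ 2 = 2 * δ * (x ^ 2 / t ^ 2) := by ring
    linarith
  have h2 := rpow_le_rpow_of_nonpos (by positivity) h1 (by norm_num : (-(1/2) : ℝ) ≤ 0)
  rw [← rpow_mul (by positivity)] at h2
  rw [fl]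
  convert h2 using 2
  ring

theorem half_cHigh_le {α t0 δl : ℝ} (hα : α ∈ Ioo (0:ℝ) (1/2)) (ht0 : 0 < t0) (hδl : 0 < δl)
    (hδ : (2:ℝ) ^ (2*α) * Gamma (2 + α) * Gamma (1/2 - α) / (3*π*Gamma (1 - α)) ≤
        Gamma (δl + 1) * t0 ^ (2*α - 1) / Gamma (δl + α + 1/2)) :
    cHigh α t0 δl / 2 ≤ 2 * δl / t0 ^ 2 := by
  have h0 := hα.1
  have h2 := Gamma_pos_of_pos (by linarith : 0 < δl + α + 1 / 2)
  have h3 := Gamma_pos_of_pos hδl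
  have h4 := (Gamma_pos_of_pos (by linarith [hα.2] : 0 < 1 - α)).ne'
  have e1 : Gamma (2 + α) = (1 + α) * Gamma (1 + α) := by
    rw [show 2 + α = (1 + α) + 1 by ring, Gamma_add_one (by linarith)]
  have e2 : (2:ℝ) ^ (2 * α - 1) = 2 ^ (2 * α) / 2 := by rw [rpow_sub two_pos, rpow_one]
  have e3 : t0 ^ (-1 - 2 * α) * t0 ^ (2 * α - 1) = (t0 ^ 2)⁻¹ := by
    rw [← rpow_add ht0, ← rpow_two, ← rpow_neg ht0.le]; congr 1; ring
  rw [Gamma_add_one hδl.ne'] at hδ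
  have hpos : 0 ≤ 2 * t0 ^ (-1 - 2 * α) * Gamma (δl + α + 1 / 2) / Gamma δl := by positivity
  calc cHigh α t0 δl / 2 = (2:ℝ) ^ (2*α) * Gamma (2 + α) * Gamma (1/2 - α) / (3*π*Gamma (1 - α)) *
        (2 * t0 ^ (-1 - 2 * α) * Gamma (δl + α + 1 / 2) / Gamma δl) := by
        rw [cHigh, C0, e1, e2]
        field_simp
        ring
    _ ≤ _ := mul_le_mul_of_nonneg_right hδ hpos
    _ = 2 * δl * (t0 ^ (-1 - 2 * α) * t0 ^ (2 * α - 1)) := by field_simp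
    _ = 2 * δl / t0 ^ 2 := by rw [e3, div_eq_mul_inv]

/-- The operator `ℜ_α` preserves the lower barrier `f_l` on `𝒲₁`:
`ℜ_α(f)(x) ≥ (1 + (c''_{0,α}/2)x²)^{-1/2} ≥ f_l(x)`. -/
theorem Rfr_lower_barrier (α t0 δl : ℝ) (hα : α ∈ Ioo (0:ℝ) (1/2)) (ht0 : 1 < t0)
    (ht1 : max (1 / C3 α) ((1 - 2*α) / (2*α * C3 α)) < t0 ^ (1/2 - α))
    (ht2 : (2:ℝ) ^ ((2:ℝ) ^ α + 2) * Real.Gamma (2 + α) * Real.Gamma (1/2 - α) /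
        (3*π*α*Real.Gamma (1 - α)) < t0 ^ (1/2 + α))
    (hδl : 1/2 ≤ δl)
    (hδ1 : (2:ℝ) ^ (2*α) * Real.Gamma (2 + α) * Real.Gamma (1/2 - α) /
        (3*π*Real.Gamma (1 - α)) ≤
        Real.Gamma (δl + 1) * t0 ^ (2*α - 1) / Real.Gamma (δl + α + 1/2))
    (hδ2 : Real.Gamma (δl + 1) * t0 ^ (2*α - 1) / Real.Gamma (δl + α + 1/2) ≤
        (2:ℝ) ^ (2*α + 1) * Real.Gamma (2 + α) * Real.Gamma (1/2 - α) /
        (3*π*Real.Gamma (1 - α)))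
    (f : ℝ → ℝ) (hf : W1 α t0 δl f) (x : ℝ) :
    (1 + cHigh α t0 δl / 2 * x^2) ^ (-(1/2) : ℝ) ≤ Rfr α f x ∧
    fl t0 δl x ≤ (1 + cHigh α t0 δl / 2 * x^2) ^ (-(1/2) : ℝ) := by
  refine ⟨rpow_neg_half_le_Rfr (half_pos (cHigh_pos hα (by linarith) (by linarith))).le
    (fun y hy => Tfr_mem hα (by linarith) (by linarith) hf hy) x, ?_⟩
  exact one_add_sq_div_rpow_neg_le hδl
    (half_pos (cHigh_pos hα (by linarith) (by linarith))).le
    (half_cHigh_le hα (by linarith) (by linarith) hδ1) x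

end GSQGhalfplane
end
end
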